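/- arXiv:2202.05034 — 2 statements merged into one kernel-verified Lean document; each statement's English description precedes it below -/
import Mathlib

section
/- Let $f\in L_p(\mathbb{T})$ be bounded, $1\le p<\infty$, $r,n\in\mathbb{N}$, let $X_n=(x_{k,n})_{k=1}^{n}$ be nodes as above, and let $0<\delta\le\min_{k}(x_{k+1,n}-x_{k,n})$. Then $\|f_{\delta,r}-f\|_{\ell_p(X_n)}\le \binom{2r}{r}^{-1}(\delta n)^{-1/p}\,\tau_{2r}(f,\delta)_p$. -/
open MeasureTheory Filter Finset

noncomputable def LpNorm (p : ℝ) (f : ℝ → ℝ) : ℝ :=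
  (∫ x in (0:ℝ)..1, |f x| ^ p) ^ (1 / p)

def MemLpT (p : ℝ) (f : ℝ → ℝ) : Prop :=
  Function.Periodic f 1 ∧ Measurable f ∧
    IntervalIntegrable (fun x => |f x| ^ p) MeasureTheory.volume 0 1

noncomputable def Delta (r : ℕ) (h : ℝ) (f : ℝ → ℝ) (x : ℝ) : ℝ :=
  ∑ ν ∈ Finset.range (r + 1), ((-1 : ℝ) ^ ν * (r.choose ν : ℝ)) * f (x + ((r : ℝ) - (ν : ℝ)) * h)

noncomputable def omegaMod (r : ℕ) (p : ℝ) (f : ℝ → ℝ) (δ : ℝ) : ℝ :=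
  sSup {y | ∃ h : ℝ, 0 < h ∧ h < δ ∧ y = LpNorm p (Delta r h f)}

noncomputable def steklov (r : ℕ) (δ : ℝ) (f : ℝ → ℝ) (x : ℝ) : ℝ :=
  (-1 : ℝ) ^ (r + 1) * (((2 * r).choose r : ℝ))⁻¹ * (2 / δ) *
    ∫ t in (-(δ / 2))..(δ / 2),
      ∑ ν ∈ Finset.range r,
        (-1 : ℝ) ^ ν * (((2 * r).choose ν : ℝ)) * f (x + (((r : ℝ) - (ν : ℝ)) / (r : ℝ)) * t)

noncomputable def ellp (p : ℝ) (n : ℕ) (x : ℕ → ℝ) (f : ℝ → ℝ) : ℝ :=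
  ((1 / (n : ℝ)) * ∑ k ∈ Finset.range n, |f (x k)| ^ p) ^ (1 / p)

def SobolevW (s : ℕ) (g : ℝ → ℝ) : Prop :=
  Function.Periodic g 1 ∧ ContDiff ℝ (s : ℕ∞) g

noncomputable def localMod (r : ℕ) (f : ℝ → ℝ) (x δ : ℝ) : ℝ :=
  sSup {y | ∃ t h : ℝ, t ∈ Set.Icc (x - r * δ / 2) (x + r * δ / 2) ∧
    (t + r * h) ∈ Set.Icc (x - r * δ / 2) (x + r * δ / 2) ∧ y = |Delta r h f t|}

noncomputable def tauMod (r : ℕ) (p : ℝ) (f : ℝ → ℝ) (δ : ℝ) : ℝ :=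
  (∫ x in (0:ℝ)..1, localMod r f x δ ^ p) ^ (1 / p)

def IsTrigPoly (n : ℕ) (T : ℝ → ℝ) : Prop :=
  ∃ c : ℤ → ℂ, ∀ x : ℝ, (T x : ℂ) =
    ∑ ℓ ∈ Finset.Icc (-(n : ℤ)) (n : ℤ),
      c ℓ * Complex.exp (2 * Real.pi * Complex.I * (ℓ : ℂ) * (x : ℂ))

noncomputable def tildeE (n : ℕ) (p : ℝ) (f : ℝ → ℝ) : ℝ :=
  sInf {y | ∃ Q q : ℝ → ℝ, IsTrigPoly n Q ∧ IsTrigPoly n q ∧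
    (∀ x, q x ≤ f x ∧ f x ≤ Q x) ∧ y = LpNorm p (fun x => Q x - q x)}

noncomputable def dirichlet (n : ℕ) (x : ℝ) : ℝ :=
  ∑ ℓ ∈ Finset.Icc (-(n : ℤ)) (n : ℤ), Real.cos (2 * Real.pi * (ℓ : ℝ) * x)

noncomputable def lagrange (n : ℕ) (f : ℝ → ℝ) (x : ℝ) : ℝ :=
  (1 / (2 * (n : ℝ) + 1)) * ∑ k ∈ Finset.range (2 * n + 1),
    f ((k : ℝ) / (2 * (n : ℝ) + 1)) * dirichlet n (x - (k : ℝ) / (2 * (n : ℝ) + 1))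

def NodesOK (γ : ℝ) (X : ℕ → ℕ → ℝ) : Prop :=
  ∀ n : ℕ, 1 ≤ n →
    (0 ≤ X n 0) ∧ (∀ k, k + 1 < n → X n k < X n (k + 1)) ∧ (X n (n - 1) < 1) ∧
    (∀ k, k + 1 < n → γ / (n : ℝ) ≤ X n (k + 1) - X n k) ∧
    (γ / (n : ℝ) ≤ 1 + X n 0 - X n (n - 1))

def NodesOrd (X : ℕ → ℕ → ℝ) : Prop :=
  ∀ n : ℕ, 1 ≤ n →
    (0 ≤ X n 0) ∧ (∀ k, k + 1 < n → X n k < X n (k + 1)) ∧ (X n (n - 1) < 1)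

def SamplingForm (p : ℝ) (X : ℕ → ℕ → ℝ) (φ : ℕ → ℕ → ℝ → ℝ)
    (G : ℕ → (ℝ → ℝ) → ℝ → ℝ) : Prop :=
  (∀ n k, MemLpT p (φ n k)) ∧
  ∀ (n : ℕ) (f : ℝ → ℝ) (x : ℝ), G n f x = ∑ k ∈ Finset.range n, f (X n k) * φ n k x

def CondC1 (p K1 : ℝ) (X : ℕ → ℕ → ℝ) (G : ℕ → (ℝ → ℝ) → ℝ → ℝ) : Prop :=
  ∀ f : ℝ → ℝ, MemLpT p f → ∀ n : ℕ, 1 ≤ n → LpNorm p (G n f) ≤ K1 * ellp p n (X n) f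

def CondC1' (p K2 : ℝ) (X : ℕ → ℕ → ℝ) (G : ℕ → (ℝ → ℝ) → ℝ → ℝ) : Prop :=
  ∀ f : ℝ → ℝ, MemLpT p f → ∀ n : ℕ, 1 ≤ n → K2 * ellp p n (X n) f ≤ LpNorm p (G n f)

def CondC2' (p K3 : ℝ) (s : ℕ) (G : ℕ → (ℝ → ℝ) → ℝ → ℝ) : Prop :=
  ∀ g : ℝ → ℝ, SobolevW s g → ∀ n : ℕ, 1 ≤ n →
    LpNorm p (fun x => g x - G n g x) ≤ K3 / (n : ℝ) ^ s * LpNorm p (iteratedDeriv s g)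

def CondC3 (p K5 : ℝ) (s : ℕ) (G : ℕ → (ℝ → ℝ) → ℝ → ℝ) : Prop :=
  ∀ f : ℝ → ℝ, MemLpT p f → ∀ n : ℕ, 1 ≤ n →
    SobolevW s (G n f) ∧
    (1 / (n : ℝ) ^ s) * LpNorm p (iteratedDeriv s (G n f)) ≤
      K5 * omegaMod s p (G n f) (1 / (n : ℝ))

noncomputable def Gprev (G : ℕ → (ℝ → ℝ) → ℝ → ℝ) (f : ℝ → ℝ) (ν : ℕ) : ℝ → ℝ :=
  if ν = 0 then fun _ => 0 else G (2 ^ (ν - 1)) f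

def CondC4 (p K4 : ℝ) (s : ℕ) (G : ℕ → (ℝ → ℝ) → ℝ → ℝ) (f : ℝ → ℝ) : Prop :=
  ∀ ν : ℕ,
    SobolevW s (fun x => G (2 ^ ν) f x - Gprev G f ν x) ∧
    LpNorm p (iteratedDeriv s (fun x => G (2 ^ ν) f x - Gprev G f ν x)) ≤
      K4 * 2 ^ (s * ν) * LpNorm p (fun x => G (2 ^ ν) f x - Gprev G f ν x)

noncomputable def Kfun (s : ℕ) (p : ℝ) (n : ℕ) (x : ℕ → ℝ) (f : ℝ → ℝ) : ℝ :=
  sInf {y | ∃ g : ℝ → ℝ, SobolevW s g ∧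
    y = ellp p n x (fun t => f t - g t) + LpNorm p (fun t => f t - g t) +
        (1 / (n : ℝ) ^ s) * LpNorm p (iteratedDeriv s g)}

lemma aux_sum_split (r : ℕ) (g : ℕ → ℝ) :
    ∑ ν ∈ Finset.range (2 * r + 1), g ν =
      ∑ ν ∈ Finset.range r, g ν + ∑ ν ∈ Finset.range r, g (2 * r - ν) + g r := by
  have h1 : 2 * r + 1 = r + (r + 1) := by ring
  rw [h1, Finset.sum_range_add, Finset.sum_range_succ', ← Finset.sum_range_reflect (fun k => g (r + (k + 1)))]
  rw [add_assoc]
  congr 2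
  apply Finset.sum_congr rfl
  intro k hk
  rw [Finset.mem_range] at hk
  congr 1
  omega

lemma aux_sym (r : ℕ) (hr : 1 ≤ r) (f : ℝ → ℝ) (x t : ℝ) :
    Delta (2 * r) (t / r) f (x - t) =
      (∑ ν ∈ Finset.range r,
        (-1 : ℝ) ^ ν * (((2 * r).choose ν : ℝ)) * f (x + (((r : ℝ) - (ν : ℝ)) / (r : ℝ)) * t)) +
      (∑ ν ∈ Finset.range r,
        (-1 : ℝ) ^ ν * (((2 * r).choose ν : ℝ)) * f (x + (((r : ℝ) - (ν : ℝ)) / (r : ℝ)) * (-t))) +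
      (-1) ^ r * ((2 * r).choose r : ℝ) * f x := by
  have hr0 : (r : ℝ) ≠ 0 := by positivity
  unfold Delta
  rw [aux_sum_split]
  congr 1
  · congr 1
    · apply Finset.sum_congr rfl
      intro ν hν
      congr 2
      push_cast
      field_simp
      ring
    · apply Finset.sum_congr rfl
      intro ν hν
      rw [Finset.mem_range] at hν
      have hle : ν ≤ 2 * r := by omega
      rw [Nat.choose_symm hle, Nat.cast_sub hle]
      congr 1
      · congr 1
        have h2 : (-1 : ℝ) ^ (2 * r - ν) * (-1) ^ ν = 1 := by
          rw [← pow_add, Nat.sub_add_cancel hle, pow_mul]; simp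
        have h3 : (-1 : ℝ) ^ ν * (-1) ^ ν = 1 := by
          rw [← pow_add, ← two_mul, pow_mul]; simp
        calc (-1 : ℝ) ^ (2 * r - ν) = (-1 : ℝ) ^ (2 * r - ν) * ((-1 : ℝ) ^ ν * (-1) ^ ν) := by
              rw [h3, mul_one]
          _ = (-1 : ℝ) ^ ν := by rw [← mul_assoc, h2, one_mul]
      · congr 1
        push_cast
        field_simp
        ring
  · congr 2
    push_cast
    field_simp
    ring

lemma aux_integrable (g : ℝ → ℝ) (hg : Measurable g) (M : ℝ) (hM : ∀ x, |g x| ≤ M) (a b : ℝ) :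
    IntervalIntegrable g volume a b := by
  apply (intervalIntegrable_const (c := M)).mono_fun hg.aestronglyMeasurable
  refine Filter.Eventually.of_forall fun x => ?_
  simp only [Real.norm_eq_abs]
  exact (hM x).trans (le_abs_self M)

lemma aux_bdd_Delta (m : ℕ) (f : ℝ → ℝ) (M : ℝ) (hM : ∀ x, |f x| ≤ M) :
    ∃ K, ∀ t h, |Delta m h f t| ≤ K := by
  refine ⟨∑ ν ∈ Finset.range (m + 1), |((-1 : ℝ) ^ ν * (m.choose ν : ℝ))| * M, fun t h => ?_⟩
  unfold Delta
  refine (Finset.abs_sum_le_sum_abs _ _).trans (Finset.sum_le_sum fun ν _ => ?_)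
  rw [abs_mul]
  exact mul_le_mul_of_nonneg_left (hM _) (abs_nonneg _)

lemma aux_steklov (r : ℕ) (hr : 1 ≤ r) (f : ℝ → ℝ) (hf : Measurable f) (M : ℝ)
    (hM : ∀ x, |f x| ≤ M) (δ : ℝ) (hδ : 0 < δ) (x W : ℝ)
    (hW : ∀ t, |t| ≤ δ / 2 → |Delta (2 * r) (t / r) f (x - t)| ≤ W) :
    |steklov r δ f x - f x| ≤ (((2 * r).choose r : ℝ))⁻¹ * W := by
  set S : ℝ → ℝ := fun t => ∑ ν ∈ Finset.range r,
        (-1 : ℝ) ^ ν * (((2 * r).choose ν : ℝ)) * f (x + (((r : ℝ) - (ν : ℝ)) / (r : ℝ)) * t) with hS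
  have hC : (0 : ℝ) < ((2 * r).choose r : ℝ) := by
    exact_mod_cast Nat.choose_pos (by omega)
  have hSm : Measurable S := by
    refine Finset.measurable_fun_sum _ fun ν _ => ?_
    exact (hf.comp (by fun_prop)).const_mul _
  have hSb : ∃ K, ∀ t, |S t| ≤ K := by
    refine ⟨∑ ν ∈ Finset.range r, |(-1 : ℝ) ^ ν * (((2 * r).choose ν : ℝ))| * M, fun t => ?_⟩
    refine (Finset.abs_sum_le_sum_abs _ _).trans (Finset.sum_le_sum fun ν _ => ?_)
    rw [abs_mul]
    exact mul_le_mul_of_nonneg_left (hM _) (abs_nonneg _)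
  obtain ⟨K, hK⟩ := hSb
  have hI1 := aux_integrable S hSm K hK (-(δ / 2)) (δ / 2)
  have hI2 := aux_integrable (fun t => S (-t)) (hSm.comp measurable_neg) K (fun t => hK _)
    (-(δ / 2)) (δ / 2)
  have hneg : ∫ t in (-(δ / 2))..(δ / 2), S (-t) = ∫ t in (-(δ / 2))..(δ / 2), S t := by
    rw [intervalIntegral.integral_comp_neg]; simp
  have hD : ∫ t in (-(δ / 2))..(δ / 2), Delta (2 * r) (t / r) f (x - t) =
      2 * (∫ t in (-(δ / 2))..(δ / 2), S t) + δ * ((-1) ^ r * ((2 * r).choose r : ℝ) * f x) := by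
    have : ∀ t, Delta (2 * r) (t / r) f (x - t) =
        S t + S (-t) + (-1) ^ r * ((2 * r).choose r : ℝ) * f x := fun t => aux_sym r hr f x t
    simp only [this]
    rw [intervalIntegral.integral_add (hI1.add hI2) intervalIntegrable_const,
      intervalIntegral.integral_add hI1 hI2, hneg, intervalIntegral.integral_const]
    simp only [smul_eq_mul]
    ring
  have hb : |∫ t in (-(δ / 2))..(δ / 2), Delta (2 * r) (t / r) f (x - t)| ≤ W * δ := by
    have := intervalIntegral.norm_integral_le_of_norm_le_const (a := -(δ / 2)) (b := δ / 2)
      (C := W) (f := fun t => Delta (2 * r) (t / r) f (x - t)) (fun t ht => by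
        rw [Set.uIoc_of_le (by linarith)] at ht
        exact hW t (abs_le.2 ⟨ht.1.le, ht.2⟩))
    rw [Real.norm_eq_abs] at this
    refine this.trans (le_of_eq ?_)
    rw [abs_of_pos (by linarith)]; ring
  have hst : steklov r δ f x - f x = (-1 : ℝ) ^ (r + 1) * (((2 * r).choose r : ℝ)⁻¹ * δ⁻¹ *
      ∫ t in (-(δ / 2))..(δ / 2), Delta (2 * r) (t / r) f (x - t)) := by
    rw [hD]
    unfold steklov
    change (-1 : ℝ) ^ (r + 1) * (((2 * r).choose r : ℝ))⁻¹ * (2 / δ) *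
      (∫ t in (-(δ / 2))..(δ / 2), S t) - f x = _
    have h3 : (-1 : ℝ) ^ r * (-1) ^ r = 1 := by
      rw [← pow_add, ← two_mul, pow_mul]; simp
    generalize (∫ t in (-(δ / 2))..(δ / 2), S t) = J
    rw [pow_succ]
    field_simp
    linear_combination ((δ * f x * ((2 * r).choose r : ℝ))) * h3
  rw [hst, abs_mul, abs_pow, abs_neg, abs_one, one_pow, one_mul, abs_mul, abs_of_pos (by positivity)]
  calc _ ≤ ((2 * r).choose r : ℝ)⁻¹ * δ⁻¹ * (W * δ) := by gcongr
    _ = _ := by field_simp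

lemma aux_localMod_bdd (m : ℕ) (f : ℝ → ℝ) (M : ℝ) (hM : ∀ x, |f x| ≤ M) (x δ : ℝ) :
    BddAbove {y | ∃ t h : ℝ, t ∈ Set.Icc (x - m * δ / 2) (x + m * δ / 2) ∧
    (t + m * h) ∈ Set.Icc (x - m * δ / 2) (x + m * δ / 2) ∧ y = |Delta m h f t|} := by
  obtain ⟨K, hK⟩ := aux_bdd_Delta m f M hM
  refine ⟨K, ?_⟩
  rintro y ⟨t, h, -, -, rfl⟩
  exact hK t h

lemma aux_localMod_nonneg (m : ℕ) (f : ℝ → ℝ) (x δ : ℝ) : 0 ≤ localMod m f x δ := by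
  apply Real.sSup_nonneg
  rintro y ⟨t, h, -, -, rfl⟩
  exact abs_nonneg _

lemma aux_localMod_le (m : ℕ) (f : ℝ → ℝ) (M : ℝ) (hM : ∀ x, |f x| ≤ M) :
    ∃ K, ∀ x δ, localMod m f x δ ≤ K := by
  obtain ⟨K, hK⟩ := aux_bdd_Delta m f M hM
  refine ⟨K, fun x δ => Real.sSup_le ?_ ((abs_nonneg _).trans (hK 0 0))⟩
  rintro y ⟨t, h, -, -, rfl⟩
  exact hK t h

lemma aux_Delta_per (m : ℕ) (f : ℝ → ℝ) (hf : Function.Periodic f 1) (h t : ℝ) :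
    Delta m h f (t + 1) = Delta m h f t := by
  unfold Delta
  refine Finset.sum_congr rfl fun ν _ => ?_
  rw [← hf (t + _)]
  congr 2
  ring

lemma aux_localMod_per (m : ℕ) (f : ℝ → ℝ) (hf : Function.Periodic f 1) (δ : ℝ) :
    Function.Periodic (fun x => localMod m f x δ) 1 := by
  intro x
  simp only [localMod]
  congr 1
  ext y
  simp only [Set.mem_ofPred_eq, Set.mem_Icc]
  constructor
  · rintro ⟨t, h, ⟨h1, h2⟩, ⟨h3, h4⟩, rfl⟩
    refine ⟨t - 1, h, ⟨by linarith, by linarith⟩, ⟨by linarith, by linarith⟩, ?_⟩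
    rw [← aux_Delta_per m f hf h (t - 1), sub_add_cancel]
  · rintro ⟨t, h, ⟨h1, h2⟩, ⟨h3, h4⟩, rfl⟩
    refine ⟨t + 1, h, ⟨by linarith, by linarith⟩, ⟨by linarith, by linarith⟩, ?_⟩
    rw [aux_Delta_per m f hf h]

lemma aux_meas_Ico (P : ℝ → ℝ → Prop) :
    MeasurableSet {u : ℝ | ∃ a b, P a b ∧ a ≤ u ∧ u < b} := by
  apply MeasurableSet.of_mem_nhdsGT
  rintro u ⟨a, b, hP, h1, h2⟩
  filter_upwards [Ioo_mem_nhdsGT h2] with v hv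
  exact ⟨a, b, hP, h1.trans hv.1.le, hv.2⟩

lemma aux_meas_Ioc (P : ℝ → ℝ → Prop) :
    MeasurableSet {u : ℝ | ∃ a b, P a b ∧ a < u ∧ u ≤ b} := by
  have h := measurable_neg (aux_meas_Ico fun a b => P (-b) (-a))
  convert h using 1
  ext u
  simp only [Set.mem_ofPred_eq, Set.mem_preimage]
  constructor
  · rintro ⟨a, b, hP, h1, h2⟩
    exact ⟨-b, -a, by simpa using hP, by linarith, by linarith⟩
  · rintro ⟨a, b, hP, h1, h2⟩
    exact ⟨-b, -a, hP, by linarith, by linarith⟩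

lemma aux_Delta_meas (m : ℕ) (f : ℝ → ℝ) (hf : Measurable f) (h : ℝ) :
    Measurable (Delta m h f) := by
  unfold Delta
  refine Finset.measurable_fun_sum _ fun ν _ => ?_
  exact (hf.comp (by fun_prop)).const_mul _

lemma aux_localMod_meas (m : ℕ) (hm : 1 ≤ m) (f : ℝ → ℝ) (hf : Measurable f) (M : ℝ)
    (hM : ∀ x, |f x| ≤ M) (δ : ℝ) (hδ : 0 < δ) :
    Measurable (fun x => localMod m f x δ) := by
  have hm0 : (0 : ℝ) < m := by exact_mod_cast hm
  apply measurable_of_Ioi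
  intro c
  set R : ℝ := m * δ / 2 with hR
  have hR0 : 0 < R := by positivity
  let P : ℝ → ℝ → Prop := fun a b => ∃ t h, c < |Delta m h f t| ∧
    a = max t (t + m * h) - R ∧ b = min t (t + m * h) + R
  have e1 : MeasurableSet {u : ℝ | c < |Delta m δ f (u - R)|} :=
    measurableSet_lt measurable_const
      (((aux_Delta_meas m f hf δ).comp (by fun_prop : Measurable fun u : ℝ => u - R)).abs)
  have e2 : MeasurableSet {u : ℝ | c < |Delta m (-δ) f (u + R)|} :=
    measurableSet_lt measurable_const
      (((aux_Delta_meas m f hf (-δ)).comp (by fun_prop : Measurable fun u : ℝ => u + R)).abs)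
  convert ((aux_meas_Ico P).union (aux_meas_Ioc P)).union (e1.union e2) using 1
  ext u
  simp only [Set.mem_preimage, Set.mem_Ioi, Set.mem_union, Set.mem_ofPred_eq, localMod]
  rw [lt_csSup_iff (aux_localMod_bdd m f M hM u δ)
    ⟨|Delta m 0 f u|, u, 0, by simp only [Set.mem_Icc]; constructor <;> linarith,
      by simp only [Set.mem_Icc, mul_zero, add_zero]; constructor <;> linarith, rfl⟩]
  simp only [Set.mem_ofPred_eq, ← hR, Set.mem_Icc]
  constructor
  · rintro ⟨y, ⟨t, h, ⟨h1, h2⟩, ⟨h3, h4⟩, rfl⟩, hy⟩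
    have hmax : max t (t + m * h) ≤ u + R := max_le h2 h4
    have hmin : u - R ≤ min t (t + m * h) := le_min h1 h3
    by_cases hA : u < min t (t + m * h) + R
    · exact Or.inl (Or.inl ⟨_, _, ⟨t, h, hy, rfl, rfl⟩, by linarith, hA⟩)
    by_cases hB : max t (t + m * h) - R < u
    · exact Or.inl (Or.inr ⟨_, _, ⟨t, h, hy, rfl, rfl⟩, hB, by linarith⟩)
    right
    have e3 : min t (t + m * h) = u - R := by linarith
    have e4 : max t (t + m * h) = u + R := by linarith
    rcases le_total t (t + m * h) with hle | hle
    · rw [min_eq_left hle] at e3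
      rw [max_eq_right hle] at e4
      left
      have : h = δ := by
        have : m * h = m * δ := by rw [hR] at e3 e4; linarith
        exact mul_left_cancel₀ hm0.ne' this
      rw [← e3, ← this]; exact hy
    · rw [min_eq_right hle] at e3
      rw [max_eq_left hle] at e4
      right
      have : h = -δ := by
        have : m * h = m * (-δ) := by rw [hR] at e3 e4; linarith
        exact mul_left_cancel₀ hm0.ne' this
      rw [← e4, ← this]; exact hy
  · have key : ∀ t h, c < |Delta m h f t| → max t (t + m * h) - R ≤ u →
        u ≤ min t (t + m * h) + R →
        ∃ b, (∃ t h : ℝ, (u - R ≤ t ∧ t ≤ u + R) ∧ (u - R ≤ t + m * h ∧ t + m * h ≤ u + R) ∧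
          b = |Delta m h f t|) ∧ c < b := by
      intro t h hc h1 h2
      have := le_max_left t (t + m * h)
      have := le_max_right t (t + m * h)
      have := min_le_left t (t + m * h)
      have := min_le_right t (t + m * h)
      exact ⟨_, ⟨t, h, ⟨by linarith, by linarith⟩, ⟨by linarith, by linarith⟩, rfl⟩, hc⟩
    rintro ((⟨a, b, ⟨t, h, hc, rfl, rfl⟩, h1, h2⟩ | ⟨a, b, ⟨t, h, hc, rfl, rfl⟩, h1, h2⟩) | hc | hc)
    · exact key t h hc h1 h2.le
    · exact key t h hc h1.le h2
    · exact ⟨_, ⟨u - R, δ, ⟨by linarith, by linarith⟩, ⟨by linarith, by linarith⟩, rfl⟩, hc⟩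
    · exact ⟨_, ⟨u + R, -δ, ⟨by linarith, by linarith⟩, ⟨by linarith, by linarith⟩, rfl⟩, hc⟩

lemma aux_point (r : ℕ) (hr : 1 ≤ r) (f : ℝ → ℝ) (hf : Measurable f) (M : ℝ)
    (hM : ∀ x, |f x| ≤ M) (δ : ℝ) (hδ : 0 < δ) (x u : ℝ) (hu : |u - x| ≤ δ / 2) :
    |steklov r δ f x - f x| ≤ (((2 * r).choose r : ℝ))⁻¹ * localMod (2 * r) f u δ := by
  apply aux_steklov r hr f hf M hM δ hδ
  intro t ht
  have hr1 : (1 : ℝ) ≤ r := by exact_mod_cast hr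
  have hr0 : (r : ℝ) ≠ 0 := by positivity
  have hrd : δ ≤ r * δ := by nlinarith
  apply le_csSup (aux_localMod_bdd (2 * r) f M hM u δ)
  rw [abs_le] at hu ht
  have e : x - t + ((2 * r : ℕ) : ℝ) * (t / r) = x + t := by
    push_cast; field_simp; ring
  refine ⟨x - t, t / r, ?_, ?_, rfl⟩
  · push_cast
    constructor <;> linarith [hu.1, hu.2, ht.1, ht.2]
  · rw [e]
    push_cast
    constructor <;> linarith [hu.1, hu.2, ht.1, ht.2]

lemma aux_sum_int (g : ℝ → ℝ) (hg : ∀ a b, IntervalIntegrable g volume a b)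
    (hg0 : ∀ u, 0 ≤ g u) (y : ℕ → ℝ) (δ : ℝ) (n : ℕ)
    (hy : ∀ k, k + 1 < n + 1 → δ ≤ y (k + 1) - y k) :
    ∑ k ∈ Finset.range (n + 1), ∫ u in (y k)..(y k + δ), g u ≤ ∫ u in (y 0)..(y n + δ), g u := by
  induction n with
  | zero => simp
  | succ n ih =>
    rw [Finset.sum_range_succ]
    have h1 := ih (fun k hk => hy k (by omega))
    have h2 := hy n (by omega)
    have h3 : 0 ≤ ∫ u in (y n + δ)..(y (n + 1)), g u :=
      intervalIntegral.integral_nonneg (by linarith) fun u _ => hg0 u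
    have h4 := intervalIntegral.integral_add_adjacent_intervals (hg (y 0) (y n + δ))
      (hg (y n + δ) (y (n + 1)))
    have h5 := intervalIntegral.integral_add_adjacent_intervals (hg (y 0) (y (n + 1)))
      (hg (y (n + 1)) (y (n + 1) + δ))
    linarith

theorem stmt1 (p : ℝ) (hp : 1 ≤ p) (f : ℝ → ℝ) (hf : MemLpT p f)
    (hbdd : ∃ M : ℝ, ∀ x, |f x| ≤ M) (r n : ℕ) (hr : 1 ≤ r) (hn : 1 ≤ n)
    (x : ℕ → ℝ) (hx0 : 0 ≤ x 0) (hxmono : ∀ k, k + 1 < n → x k < x (k + 1))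
    (hxlast : x (n - 1) < 1) (δ : ℝ) (hδ : 0 < δ)
    (hδmesh : (∀ k, k + 1 < n → δ ≤ x (k + 1) - x k) ∧ δ ≤ 1 + x 0 - x (n - 1)) :
    ellp p n x (fun t => steklov r δ f t - f t) ≤
      (((2 * r).choose r : ℝ))⁻¹ * (δ * (n : ℝ)) ^ (-(1 / p)) * tauMod (2 * r) p f δ := by
  obtain ⟨hper, hmeas, -⟩ := hf
  obtain ⟨M, hM⟩ := hbdd
  have hp0 : 0 < p := by linarith
  set C : ℝ := (((2 * r).choose r : ℝ))⁻¹ with hCdef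
  have hC : 0 < C := by
    have : 0 < (2 * r).choose r := Nat.choose_pos (by omega)
    positivity
  set g : ℝ → ℝ := fun u => localMod (2 * r) f u δ ^ p with hgdef
  have hn0 : (0 : ℝ) < n := by exact_mod_cast hn
  have hω0 : ∀ u, 0 ≤ localMod (2 * r) f u δ := fun u => aux_localMod_nonneg _ _ _ _
  have hg0 : ∀ u, 0 ≤ g u := fun u => Real.rpow_nonneg (hω0 u) _
  have hgper : Function.Periodic g 1 := fun u => by
    have := aux_localMod_per (2 * r) f hper δ u
    simp only [hgdef] at this ⊢
    rw [this]
  have hgm : Measurable g :=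
    (aux_localMod_meas (2 * r) (by omega) f hmeas M hM δ hδ).pow_const p
  obtain ⟨K, hK⟩ := aux_localMod_le (2 * r) f M hM
  have hgi : ∀ a b, IntervalIntegrable g volume a b :=
    aux_integrable g hgm (K ^ p) fun u => by
      rw [abs_of_nonneg (hg0 u)]
      exact Real.rpow_le_rpow (hω0 u) (hK u δ) hp0.le
  have hpt : ∀ k, δ * |steklov r δ f (x k) - f (x k)| ^ p ≤
      C ^ p * ∫ u in (x k - δ / 2)..(x k - δ / 2 + δ), g u := by
    intro k
    rw [← intervalIntegral.integral_const_mul]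
    have h1 : ∫ u in (x k - δ / 2)..(x k - δ / 2 + δ), |steklov r δ f (x k) - f (x k)| ^ p =
        δ * |steklov r δ f (x k) - f (x k)| ^ p := by
      rw [intervalIntegral.integral_const, smul_eq_mul]; ring
    rw [← h1]
    apply intervalIntegral.integral_mono_on (by linarith) intervalIntegrable_const
      ((hgi _ _).const_mul _)
    intro u hu
    rw [hgdef]
    simp only
    rw [← Real.mul_rpow hC.le (hω0 u)]
    apply Real.rpow_le_rpow (abs_nonneg _) _ hp0.le
    apply aux_point r hr f hmeas M hM δ hδ
    rw [abs_le]
    constructor <;> linarith [hu.1, hu.2]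
  obtain ⟨nn, rfl⟩ : ∃ nn, n = nn + 1 := ⟨n - 1, by omega⟩
  have hsum := aux_sum_int g hgi hg0 (fun k => x k - δ / 2) δ nn (fun k hk => by
    have := hδmesh.1 k hk
    linarith)
  have hlast : ∫ u in (x 0 - δ / 2)..(x nn - δ / 2 + δ), g u ≤ ∫ u in (0:ℝ)..1, g u := by
    have h1 := hgper.intervalIntegral_add_eq (x 0 - δ / 2) 0
    rw [zero_add] at h1
    rw [← h1]
    have h2 := intervalIntegral.integral_add_adjacent_intervals
      (hgi (x 0 - δ / 2) (x nn - δ / 2 + δ)) (hgi (x nn - δ / 2 + δ) (x 0 - δ / 2 + 1))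
    have h3 : 0 ≤ ∫ u in (x nn - δ / 2 + δ)..(x 0 - δ / 2 + 1), g u :=
      intervalIntegral.integral_nonneg (by have := hδmesh.2; simp only [Nat.add_sub_cancel] at this; linarith)
        fun u _ => hg0 u
    linarith
  set I := ∫ u in (0:ℝ)..1, g u with hI
  have hI0 : 0 ≤ I := intervalIntegral.integral_nonneg zero_le_one fun u _ => hg0 u
  have htot : δ * ∑ k ∈ Finset.range (nn + 1), |steklov r δ f (x k) - f (x k)| ^ p ≤ C ^ p * I := by
    rw [Finset.mul_sum]
    refine (Finset.sum_le_sum fun k _ => hpt k).trans ?_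
    rw [← Finset.mul_sum]
    exact mul_le_mul_of_nonneg_left (hsum.trans hlast) (by positivity)
  unfold ellp tauMod
  change _ ≤ C * (δ * ((nn + 1 : ℕ) : ℝ)) ^ (-(1 / p)) * I ^ (1 / p)
  have hN : 0 < δ * ((nn + 1 : ℕ) : ℝ) := by positivity
  have hfin : C * (δ * ((nn + 1 : ℕ) : ℝ)) ^ (-(1 / p)) * I ^ (1 / p) =
      (C ^ p * (δ * ((nn + 1 : ℕ) : ℝ))⁻¹ * I) ^ (1 / p) := by
    generalize δ * ((nn + 1 : ℕ) : ℝ) = N at hN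
    rw [Real.mul_rpow (by positivity) hI0, Real.mul_rpow (by positivity) (by positivity),
      ← Real.rpow_mul hC.le, mul_one_div_cancel hp0.ne', Real.rpow_one,
      Real.rpow_neg (by positivity), Real.inv_rpow (by positivity)]
  rw [hfin]
  apply Real.rpow_le_rpow (by positivity) _ (by positivity)
  rw [mul_inv, one_div]
  calc _ = ((nn + 1 : ℕ) : ℝ)⁻¹ * δ⁻¹ *
        (δ * ∑ k ∈ Finset.range (nn + 1), |steklov r δ f (x k) - f (x k)| ^ p) := by
        field_simp
    _ ≤ ((nn + 1 : ℕ) : ℝ)⁻¹ * δ⁻¹ * (C ^ p * I) := by gcongr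
    _ = _ := by ring
end

section
/- Let $f$ be a bounded measurable 1-periodic function and $1\le p<\infty$. There exists a constant $G>0$ such that $\tau_1(f,1/n)_p\le G\,\widetilde{E}_n(f)_p$ for all $n\in\mathbb{N}$ if and only if there exists a constant $F>0$ such that $\tau_1(f,\delta)_p\le F\,\tau_{2}(f,\delta)_p$ for all $\delta>0$. -/
open MeasureTheory Filter Finset

/-- bounded measurable periodic functions -/
def Nice (f : ℝ → ℝ) : Prop :=
  Function.Periodic f 1 ∧ Measurable f ∧ ∃ M : ℝ, ∀ x, |f x| ≤ M

theorem Nice.add {f g : ℝ → ℝ} (hf : Nice f) (hg : Nice g) : Nice (fun x => f x + g x) := by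
  obtain ⟨p1, m1, M1, b1⟩ := hf
  obtain ⟨p2, m2, M2, b2⟩ := hg
  refine ⟨fun x => by simp only [p1 x, p2 x], m1.add m2, M1 + M2, fun x => ?_⟩
  exact (abs_add_le _ _).trans (add_le_add (b1 x) (b2 x))

theorem Nice.const_mul {f : ℝ → ℝ} (hf : Nice f) (c : ℝ) : Nice (fun x => c * f x) := by
  obtain ⟨p1, m1, M1, b1⟩ := hf
  refine ⟨fun x => by simp only [p1 x], m1.const_mul c, |c| * M1, fun x => ?_⟩
  rw [abs_mul]
  exact mul_le_mul_of_nonneg_left (b1 x) (abs_nonneg _)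

theorem Nice.sub {f g : ℝ → ℝ} (hf : Nice f) (hg : Nice g) : Nice (fun x => f x - g x) := by
  have := hf.add (hg.const_mul (-1))
  convert this using 2
  ring

theorem Nice.abs {f : ℝ → ℝ} (hf : Nice f) : Nice (fun x => |f x|) := by
  obtain ⟨p1, m1, M1, b1⟩ := hf
  exact ⟨fun x => by simp only [p1 x], m1.abs, M1, fun x => by simpa using b1 x⟩

theorem Nice.shift {f : ℝ → ℝ} (hf : Nice f) (a : ℝ) : Nice (fun x => f (x + a)) := by
  obtain ⟨p1, m1, M1, b1⟩ := hf
  refine ⟨fun x => ?_, m1.comp (measurable_id.add_const a), M1, fun x => b1 _⟩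
  have : x + 1 + a = x + a + 1 := by ring
  simp only [this, p1 (x + a)]

theorem Nice.zero : Nice (fun _ => 0) :=
  ⟨fun x => rfl, measurable_const, 0, fun x => by simp⟩

theorem Nice.sum {ι : Type*} (s : Finset ι) (F : ι → ℝ → ℝ) (h : ∀ i ∈ s, Nice (F i)) :
    Nice (fun x => ∑ i ∈ s, F i x) := by
  classical
  induction s using Finset.induction_on with
  | empty => simpa using Nice.zero
  | insert a s ha ih =>
    simp only [Finset.sum_insert ha]
    exact (h a (by simp)).add (ih fun i hi => h i (by simp [hi]))

theorem Nice.memLp {f : ℝ → ℝ} (hf : Nice f) (p : ENNReal) :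
    MemLp f p (volume.restrict (Set.Ioc (0:ℝ) 1)) := by
  obtain ⟨p1, m1, M1, b1⟩ := hf
  exact MemLp.of_bound m1.aestronglyMeasurable M1 (Eventually.of_forall fun x => by simpa using b1 x)

theorem LpNorm_nonneg (p : ℝ) (f : ℝ → ℝ) : 0 ≤ LpNorm p f := by
  unfold LpNorm
  apply Real.rpow_nonneg
  apply intervalIntegral.integral_nonneg zero_le_one
  intro x _
  positivity

theorem LpNorm_eq {p : ℝ} (hp : 1 ≤ p) {f : ℝ → ℝ} (hf : Nice f) :
    LpNorm p f = (eLpNorm f (ENNReal.ofReal p) (volume.restrict (Set.Ioc (0:ℝ) 1))).toReal := by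
  have hp0 : 0 ≤ p := by linarith
  rw [MemLp.eLpNorm_eq_integral_rpow_norm (by simp; linarith) (by simp) (hf.memLp _)]
  rw [ENNReal.toReal_ofReal hp0, ENNReal.toReal_ofReal]
  · simp only [LpNorm, intervalIntegral.integral_of_le zero_le_one, Real.norm_eq_abs, one_div]
  · apply Real.rpow_nonneg
    apply integral_nonneg
    intro x
    positivity

theorem LpNorm_add {p : ℝ} (hp : 1 ≤ p) {f g : ℝ → ℝ} (hf : Nice f) (hg : Nice g) :
    LpNorm p (fun x => f x + g x) ≤ LpNorm p f + LpNorm p g := by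
  rw [LpNorm_eq hp hf, LpNorm_eq hp hg, LpNorm_eq hp (hf.add hg),
    ← ENNReal.toReal_add (hf.memLp _).2.ne (hg.memLp _).2.ne]
  apply ENNReal.toReal_mono
  · exact ENNReal.add_ne_top.2 ⟨(hf.memLp _).2.ne, (hg.memLp _).2.ne⟩
  · exact eLpNorm_add_le (hf.memLp 1).1 (hg.memLp 1).1 (by simpa using ENNReal.ofReal_le_ofReal hp)

theorem LpNorm_const_mul {p : ℝ} (hp : 1 ≤ p) {f : ℝ → ℝ} (hf : Nice f) (c : ℝ) :
    LpNorm p (fun x => c * f x) = |c| * LpNorm p f := by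
  rw [LpNorm_eq hp hf, LpNorm_eq hp (hf.const_mul c)]
  have := eLpNorm_const_smul c f (ENNReal.ofReal p) (volume.restrict (Set.Ioc (0:ℝ) 1))
  have h2 : (c • f) = fun x => c * f x := rfl
  rw [h2] at this
  rw [this, ENNReal.toReal_mul]
  simp

theorem LpNorm_mono {p : ℝ} (hp : 1 ≤ p) {f g : ℝ → ℝ} (hf : Nice f) (hg : Nice g)
    (h : ∀ x, |f x| ≤ |g x|) : LpNorm p f ≤ LpNorm p g := by
  rw [LpNorm_eq hp hf, LpNorm_eq hp hg]
  apply ENNReal.toReal_mono (hg.memLp _).2.ne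
  exact eLpNorm_mono (fun x => by simpa using h x)

theorem LpNorm_abs (p : ℝ) (f : ℝ → ℝ) : LpNorm p (fun x => |f x|) = LpNorm p f := by
  simp [LpNorm]

theorem LpNorm_zero {p : ℝ} (hp : 1 ≤ p) : LpNorm p (fun _ => 0) = 0 := by
  have := LpNorm_const_mul hp Nice.zero 0
  simpa using this

theorem LpNorm_sum {p : ℝ} (hp : 1 ≤ p) {ι : Type*} (s : Finset ι) (F : ι → ℝ → ℝ)
    (h : ∀ i ∈ s, Nice (F i)) :
    LpNorm p (fun x => ∑ i ∈ s, F i x) ≤ ∑ i ∈ s, LpNorm p (F i) := by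
  classical
  induction s using Finset.induction_on with
  | empty => simp [LpNorm_zero hp]
  | insert a s ha ih =>
    simp only [Finset.sum_insert ha]
    have h1 : ∀ i ∈ s, Nice (F i) := fun i hi => h i (by simp [hi])
    refine (LpNorm_add hp (h a (by simp)) (Nice.sum s F h1)).trans ?_
    gcongr
    exact ih h1

theorem LpNorm_shift (p : ℝ) {f : ℝ → ℝ} (hf : Function.Periodic f 1) (a : ℝ) :
    LpNorm p (fun x => f (x + a)) = LpNorm p f := by
  unfold LpNorm
  congr 1
  have h1 := intervalIntegral.integral_comp_add_right (a := 0) (b := 1) (fun x => |f x| ^ p) a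
  rw [h1]
  have hP : Function.Periodic (fun x => |f x| ^ p) 1 := fun x => by simp only [hf x]
  have h2 := hP.intervalIntegral_add_eq a 0
  rw [zero_add] at h2
  rw [← h2, zero_add, add_comm 1 a]

theorem Nice.conv_measure {f : ℝ → ℝ} (hf : Nice f) (ν : Measure ℝ) [IsProbabilityMeasure ν] :
    Nice (fun x => ∫ t, f (x - t) ∂ν) := by
  obtain ⟨p1, m1, M1, b1⟩ := hf
  refine ⟨fun x => ?_, ?_, M1, fun x => ?_⟩
  · have : ∀ t, f (x + 1 - t) = f (x - t) := fun t => by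
      rw [show x + 1 - t = x - t + 1 by ring, p1]
    simp only [this]
  · have : StronglyMeasurable (fun z : ℝ × ℝ => f (z.1 - z.2)) :=
      (m1.comp (measurable_fst.sub measurable_snd)).stronglyMeasurable
    exact (this.integral_prod_right').measurable
  · have := norm_integral_le_of_norm_le_const (μ := ν) (f := fun t => f (x - t)) (C := M1)
      (Eventually.of_forall fun t => by simpa using b1 _)
    simpa using this

theorem LpNorm_conv_measure {p : ℝ} (hp : 1 ≤ p) {f : ℝ → ℝ} (hf : Nice f) (ν : Measure ℝ)
    [IsProbabilityMeasure ν] :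
    LpNorm p (fun x => ∫ t, f (x - t) ∂ν) ≤ LpNorm p f := by
  have hp0 : 0 ≤ p := by linarith
  have hconv := hf.conv_measure ν
  have hf' := hf
  obtain ⟨p1, m1, M, b1⟩ := hf
  have hM : 0 ≤ M := (abs_nonneg _).trans (b1 0)
  have mz : Measurable (fun z : ℝ × ℝ => |f (z.1 - z.2)| ^ p) :=
    ((m1.comp (measurable_fst.sub measurable_snd)).abs).pow_const p
  have bz : ∀ y, ‖|f y| ^ p‖ ≤ M ^ p := fun y => by
    rw [Real.norm_eq_abs, abs_of_nonneg (by positivity)]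
    exact Real.rpow_le_rpow (abs_nonneg _) (b1 y) hp0
  have key : ∀ x, |∫ t, f (x - t) ∂ν| ^ p ≤ ∫ t, |f (x - t)| ^ p ∂ν := by
    intro x
    have mx : Measurable (fun t => f (x - t)) := m1.comp (measurable_const.sub measurable_id)
    have i1 : Integrable (fun t => |f (x - t)|) ν :=
      Integrable.of_bound mx.abs.aestronglyMeasurable M
        (Eventually.of_forall fun t => by simpa using b1 _)
    have i2 : Integrable (fun t => |f (x - t)| ^ p) ν :=
      Integrable.of_bound (mx.abs.pow_const p).aestronglyMeasurable (M ^ p)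
        (Eventually.of_forall fun t => bz _)
    have h1 : |∫ t, f (x - t) ∂ν| ≤ ∫ t, |f (x - t)| ∂ν := by
      simpa using norm_integral_le_integral_norm (μ := ν) (fun t => f (x - t))
    refine (Real.rpow_le_rpow (abs_nonneg _) h1 hp0).trans ?_
    exact (convexOn_rpow hp).map_integral_le (Real.continuous_rpow_const hp0).continuousOn
      isClosed_Ici (Eventually.of_forall fun t => Set.mem_Ici.2 (abs_nonneg _)) i1 i2
  unfold LpNorm
  apply Real.rpow_le_rpow
  · apply intervalIntegral.integral_nonneg zero_le_one
    intro x _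
    positivity
  swap
  · positivity
  rw [intervalIntegral.integral_of_le zero_le_one]
  have step : ∫ x in Set.Ioc (0:ℝ) 1, |∫ t, f (x - t) ∂ν| ^ p
      ≤ ∫ x in Set.Ioc (0:ℝ) 1, ∫ t, |f (x - t)| ^ p ∂ν := by
    apply integral_mono_of_nonneg
    · exact Eventually.of_forall fun x => by positivity
    · refine Integrable.of_bound (mz.stronglyMeasurable.integral_prod_right').aestronglyMeasurable
        (M ^ p) (Eventually.of_forall fun x => ?_)
      have := norm_integral_le_of_norm_le_const (μ := ν) (f := fun t => |f (x - t)| ^ p)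
        (C := M ^ p) (Eventually.of_forall fun t => bz _)
      simpa using this
    · exact Eventually.of_forall key
  refine step.trans ?_
  rw [integral_integral_swap]
  · have : ∀ t, ∫ x in Set.Ioc (0:ℝ) 1, |f (x - t)| ^ p = ∫ x in (0:ℝ)..1, |f x| ^ p := by
      intro t
      rw [← intervalIntegral.integral_of_le zero_le_one]
      have h1 := intervalIntegral.integral_comp_add_right (a := 0) (b := 1)
        (fun x => |f x| ^ p) (-t)
      simp only [← sub_eq_add_neg] at h1
      rw [h1]
      have hP : Function.Periodic (fun x => |f x| ^ p) 1 := fun x => by simp only [p1 x]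
      have h2 := hP.intervalIntegral_add_eq (-t) 0
      rw [zero_add] at h2
      rw [← h2, zero_sub, ← sub_eq_neg_add]
    simp [this]
  · exact Integrable.of_bound mz.aestronglyMeasurable (M ^ p) (Eventually.of_forall fun z => bz _)

theorem conv_aux {a b : ℝ} (hab : a ≤ b) {w : ℝ → ℝ} (hw : Continuous w) (hw0 : ∀ t, 0 ≤ w t)
    (hw1 : ∫ t in a..b, w t = 1) :
    ∃ ν : Measure ℝ, IsProbabilityMeasure ν ∧ ∀ F : ℝ → ℝ,
      ∫ t in a..b, F t * w t = ∫ t, F t ∂ν := by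
  refine ⟨(volume.restrict (Set.Ioc a b)).withDensity (fun t => ENNReal.ofReal (w t)), ⟨?_⟩, ?_⟩
  · rw [withDensity_apply _ MeasurableSet.univ, Measure.restrict_univ,
      ← ofReal_integral_eq_lintegral_ofReal, ← intervalIntegral.integral_of_le hab, hw1]
    · simp
    · exact (hw.intervalIntegrable a b).1
    · exact Eventually.of_forall hw0
  · intro F
    rw [integral_withDensity_eq_integral_toReal_smul (by fun_prop) (by simp),
      intervalIntegral.integral_of_le hab]
    congr 1
    ext t
    rw [ENNReal.toReal_ofReal (hw0 t), smul_eq_mul, mul_comm]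

theorem Nice.conv {a b : ℝ} (hab : a ≤ b) {w : ℝ → ℝ} (hw : Continuous w) (hw0 : ∀ t, 0 ≤ w t)
    (hw1 : ∫ t in a..b, w t = 1) {f : ℝ → ℝ} (hf : Nice f) :
    Nice (fun x => ∫ t in a..b, f (x - t) * w t) := by
  obtain ⟨ν, hν, h⟩ := conv_aux hab hw hw0 hw1
  have h' : ∀ x, ∫ t in a..b, f (x - t) * w t = ∫ t, f (x - t) ∂ν := fun x => h _
  simp only [h']
  exact hf.conv_measure ν

theorem LpNorm_conv {p : ℝ} (hp : 1 ≤ p) {a b : ℝ} (hab : a ≤ b) {w : ℝ → ℝ} (hw : Continuous w)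
    (hw0 : ∀ t, 0 ≤ w t) (hw1 : ∫ t in a..b, w t = 1) {f : ℝ → ℝ} (hf : Nice f) :
    LpNorm p (fun x => ∫ t in a..b, f (x - t) * w t) ≤ LpNorm p f := by
  obtain ⟨ν, hν, h⟩ := conv_aux hab hw hw0 hw1
  have h' : ∀ x, ∫ t in a..b, f (x - t) * w t = ∫ t, f (x - t) ∂ν := fun x => h _
  simp only [h']
  exact LpNorm_conv_measure hp hf ν


theorem localMod_nonneg (r : ℕ) (f : ℝ → ℝ) (x δ : ℝ) : 0 ≤ localMod r f x δ := by
  apply Real.sSup_nonneg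
  rintro y ⟨t, h, -, -, rfl⟩
  exact abs_nonneg _

theorem tauMod_eq (r : ℕ) (p : ℝ) (f : ℝ → ℝ) (δ : ℝ) :
    tauMod r p f δ = LpNorm p (fun x => localMod r f x δ) := by
  unfold tauMod LpNorm
  simp only [abs_of_nonneg (localMod_nonneg r f _ δ)]

theorem Delta_one (h : ℝ) (f : ℝ → ℝ) (x : ℝ) : Delta 1 h f x = f (x + h) - f x := by
  simp [Delta, Finset.sum_range_succ]
  ring

theorem Delta_two (h : ℝ) (f : ℝ → ℝ) (x : ℝ) :
    Delta 2 h f x = f (x + 2 * h) - 2 * f (x + h) + f x := by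
  simp [Delta, Finset.sum_range_succ]
  norm_num
  ring

theorem Delta_bdd {f : ℝ → ℝ} {M : ℝ} (hM : ∀ x, |f x| ≤ M) (r : ℕ) (h t : ℝ) :
    |Delta r h f t| ≤ ∑ ν ∈ Finset.range (r + 1), (r.choose ν : ℝ) * M := by
  unfold Delta
  refine (Finset.abs_sum_le_sum_abs _ _).trans (Finset.sum_le_sum fun i _ => ?_)
  rw [abs_mul, abs_mul, abs_pow]
  simp only [abs_neg, abs_one, one_pow, one_mul, Nat.abs_cast]
  exact mul_le_mul_of_nonneg_left (hM _) (Nat.cast_nonneg _)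

theorem le_localMod {f : ℝ → ℝ} (hf : Nice f) (r : ℕ) {x δ t h : ℝ}
    (h1 : t ∈ Set.Icc (x - r * δ / 2) (x + r * δ / 2))
    (h2 : (t + r * h) ∈ Set.Icc (x - r * δ / 2) (x + r * δ / 2)) :
    |Delta r h f t| ≤ localMod r f x δ := by
  obtain ⟨-, -, M, hM⟩ := hf
  apply le_csSup
  · refine ⟨∑ ν ∈ Finset.range (r + 1), (r.choose ν : ℝ) * M, ?_⟩
    rintro y ⟨t, h, -, -, rfl⟩
    exact Delta_bdd hM r h t
  · exact ⟨t, h, h1, h2, rfl⟩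

theorem le_localMod_one {f : ℝ → ℝ} (hf : Nice f) {x δ s t : ℝ}
    (h1 : |s - x| ≤ δ / 2) (h2 : |t - x| ≤ δ / 2) : |f s - f t| ≤ localMod 1 f x δ := by
  rw [abs_le] at h1 h2
  have := le_localMod hf 1 (x := x) (δ := δ) (t := t) (h := s - t)
    (by constructor <;> push_cast <;> linarith) (by constructor <;> push_cast <;> linarith)
  rwa [Delta_one, add_sub_cancel] at this

theorem le_localMod_two {f : ℝ → ℝ} (hf : Nice f) {x δ t h : ℝ}
    (h1 : |t - x| ≤ δ) (h2 : |t + 2 * h - x| ≤ δ) :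
    |f (t + 2 * h) - 2 * f (t + h) + f t| ≤ localMod 2 f x δ := by
  rw [abs_le] at h1 h2
  have := le_localMod hf 2 (x := x) (δ := δ) (t := t) (h := h)
    (by constructor <;> push_cast <;> linarith) (by constructor <;> push_cast <;> linarith)
  rwa [Delta_two] at this

theorem localMod_one_le {f : ℝ → ℝ} {x δ b : ℝ} (hb : 0 ≤ b)
    (h : ∀ s t, |s - x| ≤ δ / 2 → |t - x| ≤ δ / 2 → |f s - f t| ≤ b) : localMod 1 f x δ ≤ b := by
  apply Real.sSup_le _ hb
  rintro y ⟨t, k, ⟨h1, h2⟩, ⟨h3, h4⟩, rfl⟩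
  rw [Delta_one]
  push_cast at h1 h2 h3 h4
  apply h <;> rw [abs_le] <;> constructor <;> linarith

theorem localMod_two_le {f : ℝ → ℝ} {x δ b : ℝ} (hb : 0 ≤ b)
    (h : ∀ t h, |t - x| ≤ δ → |t + 2 * h - x| ≤ δ →
      |f (t + 2 * h) - 2 * f (t + h) + f t| ≤ b) : localMod 2 f x δ ≤ b := by
  apply Real.sSup_le _ hb
  rintro y ⟨t, k, ⟨h1, h2⟩, ⟨h3, h4⟩, rfl⟩
  rw [Delta_two]
  push_cast at h1 h2 h3 h4
  apply h <;> rw [abs_le] <;> constructor <;> linarith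

theorem localMod_mono {f : ℝ → ℝ} (hf : Nice f) (r : ℕ) (x : ℝ) {δ δ' : ℝ} (h : δ ≤ δ') :
    localMod r f x δ ≤ localMod r f x δ' := by
  apply Real.sSup_le _ (localMod_nonneg _ _ _ _)
  rintro y ⟨t, k, ⟨h1, h2⟩, ⟨h3, h4⟩, rfl⟩
  have : (r : ℝ) * δ ≤ r * δ' := by gcongr
  apply le_localMod hf <;> constructor <;> linarith

theorem meas_left {ι : Type*} (P : ι → Prop) (u v : ι → ℝ) :
    MeasurableSet {x | ∃ i, P i ∧ u i ≤ x ∧ x < v i} := by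
  apply MeasurableSet.of_mem_nhdsGT
  rintro x ⟨i, hi, h1, h2⟩
  filter_upwards [Ioo_mem_nhdsGT h2] with y hy
  exact ⟨i, hi, h1.trans hy.1.le, hy.2⟩

theorem meas_right {ι : Type*} (P : ι → Prop) (u v : ι → ℝ) :
    MeasurableSet {x | ∃ i, P i ∧ u i < x ∧ x ≤ v i} := by
  have h := meas_left P (fun i => - v i) (fun i => - u i)
  have h2 := measurable_neg (G := ℝ) h
  convert h2 using 1
  ext x
  simp only [Set.mem_setOf_eq, Set.mem_preimage, neg_le_neg_iff, neg_lt_neg_iff]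
  constructor <;> rintro ⟨i, a, b, c⟩ <;> exact ⟨i, a, c, b⟩

theorem lt_localMod {r : ℕ} {f : ℝ → ℝ} (hf : Nice f) {x δ a : ℝ} (ha : 0 ≤ a) :
    a < localMod r f x δ ↔ ∃ t h : ℝ, t ∈ Set.Icc (x - r * δ / 2) (x + r * δ / 2) ∧
    (t + r * h) ∈ Set.Icc (x - r * δ / 2) (x + r * δ / 2) ∧ a < |Delta r h f t| := by
  constructor
  · intro h
    by_contra hc
    push Not at hc
    refine absurd h (not_lt.2 (Real.sSup_le ?_ ha))
    rintro y ⟨t, k, h1, h2, rfl⟩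
    exact hc t k h1 h2
  · rintro ⟨t, h, h1, h2, h3⟩
    exact h3.trans_le (le_localMod hf r h1 h2)

theorem measurable_localMod {r : ℕ} (hr : 0 < r) {f : ℝ → ℝ} (hf : Nice f) {δ : ℝ} :
    Measurable (fun x => localMod r f x δ) := by
  apply measurable_of_Ioi
  intro a
  by_cases ha : 0 ≤ a
  swap
  · have : (fun x => localMod r f x δ) ⁻¹' Set.Ioi a = Set.univ := by
      ext x
      simp only [Set.mem_preimage, Set.mem_Ioi, Set.mem_univ, iff_true]
      exact (not_le.1 ha).trans_le (localMod_nonneg _ _ _ _)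
    rw [this]; exact MeasurableSet.univ
  have hr' : (0:ℝ) < r := by exact_mod_cast hr
  set c := r * δ / 2 with hc
  have hD : ∀ h, Measurable (fun t => |Delta r h f t|) := by
    intro h
    unfold Delta
    have := hf.2.1
    fun_prop
  have e : (fun x => localMod r f x δ) ⁻¹' Set.Ioi a =
     ({x | ∃ i : ℝ × ℝ, a < |Delta r i.2 f i.1| ∧ max i.1 (i.1 + r * i.2) - c ≤ x ∧
        x < min i.1 (i.1 + r * i.2) + c} ∪
      {x | ∃ i : ℝ × ℝ, a < |Delta r i.2 f i.1| ∧ max i.1 (i.1 + r * i.2) - c < x ∧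
        x ≤ min i.1 (i.1 + r * i.2) + c}) ∪
      (({x | a < |Delta r δ f (x - c)|} ∪ {x | a < |Delta r (-δ) f (x + c)|}) ∩ {x | 0 ≤ δ}) := by
    ext x
    simp only [Set.mem_preimage, Set.mem_Ioi, lt_localMod hf ha]
    constructor
    · rintro ⟨t, h, ⟨h1, h2⟩, ⟨h3, h4⟩, h5⟩
      have A : max t (t + r * h) - c ≤ x := by
        rw [sub_le_iff_le_add]; apply max_le <;> linarith
      have B : x ≤ min t (t + r * h) + c := by
        rw [← sub_le_iff_le_add]; apply le_min <;> linarith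
      rcases A.lt_or_eq with A' | A'
      · left; right; exact ⟨(t, h), h5, A', B⟩
      rcases B.lt_or_eq with B' | B'
      · left; left; exact ⟨(t, h), h5, A, B'⟩
      right
      have hcc : 0 ≤ δ := by
        have : 0 ≤ c := by linarith
        by_contra hneg
        push Not at hneg
        have : r * δ < 0 := mul_neg_of_pos_of_neg hr' hneg
        linarith
      refine ⟨?_, hcc⟩
      rcases le_total 0 h with hh | hh
      · left
        have : 0 ≤ r * h := by positivity
        rw [max_eq_right (by linarith)] at A'
        rw [min_eq_left (by linarith)] at B'
        have e1 : x - c = t := by linarith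
        have e2 : h = δ := by
          have : r * h = r * δ := by linarith
          exact mul_left_cancel₀ hr'.ne' this
        simp only [Set.mem_setOf_eq, e1, ← e2]; exact h5
      · right
        have : r * h ≤ 0 := mul_nonpos_of_nonneg_of_nonpos hr'.le hh
        rw [max_eq_left (by linarith)] at A'
        rw [min_eq_right (by linarith)] at B'
        have e1 : x + c = t := by linarith
        have e2 : h = -δ := by
          have : r * h = r * (-δ) := by linarith
          exact mul_left_cancel₀ hr'.ne' this
        simp only [Set.mem_setOf_eq, e1, ← e2]; exact h5
    · rintro ((⟨⟨t, h⟩, h5, A, B⟩ | ⟨⟨t, h⟩, h5, A, B⟩) | ⟨h5 | h5, hd⟩)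
      · have A := sub_le_iff_le_add.1 A
        have B := (sub_lt_iff_lt_add.2 B).le
        rw [max_le_iff] at A; rw [le_min_iff] at B
        dsimp only at A B
        exact ⟨t, h, ⟨by linarith, by linarith⟩, ⟨by linarith, by linarith⟩, h5⟩
      · have A := sub_le_iff_le_add.1 A.le
        have B := (sub_le_iff_le_add.2 B)
        rw [max_le_iff] at A; rw [le_min_iff] at B
        dsimp only at A B
        exact ⟨t, h, ⟨by linarith, by linarith⟩, ⟨by linarith, by linarith⟩, h5⟩
      · have hd : 0 ≤ δ := hd
        have : 0 ≤ r * δ := by positivity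
        exact ⟨x - c, δ, ⟨by linarith, by linarith⟩, ⟨by linarith, by linarith⟩, h5⟩
      · have hd : 0 ≤ δ := hd
        have : 0 ≤ r * δ := by positivity
        exact ⟨x + c, -δ, ⟨by linarith, by linarith⟩, ⟨by linarith, by linarith⟩, h5⟩
  rw [e]
  refine ((meas_left _ _ _).union (meas_right _ _ _)).union (((?_ : MeasurableSet _).union ?_).inter
    (MeasurableSet.const _))
  · exact measurableSet_lt measurable_const ((hD δ).comp (measurable_id.sub_const c))
  · exact measurableSet_lt measurable_const ((hD (-δ)).comp (measurable_id.add_const c))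

theorem localMod_periodic (r : ℕ) {f : ℝ → ℝ} (hf : Nice f) (δ : ℝ) :
    Function.Periodic (fun x => localMod r f x δ) 1 := by
  intro x
  have hD : ∀ h t, Delta r h f (t + 1) = Delta r h f t := by
    intro h t
    unfold Delta
    refine Finset.sum_congr rfl fun i _ => ?_
    rw [show t + 1 + ((r:ℝ) - i) * h = t + ((r:ℝ) - i) * h + 1 by ring, hf.1]
  apply le_antisymm
  · apply Real.sSup_le _ (localMod_nonneg _ _ _ _)
    rintro y ⟨t, k, ⟨h1, h2⟩, ⟨h3, h4⟩, rfl⟩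
    have := hD k (t - 1)
    rw [sub_add_cancel] at this
    rw [this]
    apply le_localMod hf <;> constructor <;> linarith
  · apply Real.sSup_le _ (localMod_nonneg _ _ _ _)
    rintro y ⟨t, k, ⟨h1, h2⟩, ⟨h3, h4⟩, rfl⟩
    rw [← hD k t]
    apply le_localMod hf <;> constructor <;> linarith

theorem Nice.localMod {f : ℝ → ℝ} (hf : Nice f) {r : ℕ} (hr : 0 < r) (δ : ℝ) :
    Nice (fun x => localMod r f x δ) := by
  refine ⟨localMod_periodic r hf δ, measurable_localMod hr hf, ?_⟩
  obtain ⟨-, -, M, hM⟩ := hf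
  have hM0 : 0 ≤ M := (abs_nonneg _).trans (hM 0)
  refine ⟨∑ ν ∈ Finset.range (r + 1), (r.choose ν : ℝ) * M, fun x => ?_⟩
  rw [abs_of_nonneg (localMod_nonneg _ _ _ _)]
  apply Real.sSup_le _ (Finset.sum_nonneg fun i _ => by positivity)
  rintro y ⟨t, h, -, -, rfl⟩
  exact Delta_bdd hM r h t

theorem tauMod_nonneg (r : ℕ) (p : ℝ) (f : ℝ → ℝ) (δ : ℝ) : 0 ≤ tauMod r p f δ := by
  rw [tauMod_eq]; exact LpNorm_nonneg _ _

theorem LpNorm_mono' {p : ℝ} (hp : 1 ≤ p) {f g : ℝ → ℝ} (hf : Nice f) (hg : Nice g)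
    (h : ∀ x, |f x| ≤ g x) : LpNorm p f ≤ LpNorm p g :=
  LpNorm_mono hp hf hg fun x => (h x).trans (le_abs_self _)

/-- bounding tau by pointwise bound of the local modulus -/
theorem tauMod_le {p : ℝ} (hp : 1 ≤ p) {f g : ℝ → ℝ} (hf : Nice f) (hg : Nice g) {r : ℕ}
    (hr : 0 < r) {δ : ℝ} (h : ∀ x, localMod r f x δ ≤ g x) : tauMod r p f δ ≤ LpNorm p g := by
  rw [tauMod_eq]
  apply LpNorm_mono' hp (hf.localMod hr δ) hg
  intro x
  rw [abs_of_nonneg (localMod_nonneg _ _ _ _)]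
  exact h x

theorem tauMod_mono {p : ℝ} (hp : 1 ≤ p) {f : ℝ → ℝ} (hf : Nice f) {r : ℕ}
    (hr : 0 < r) {δ δ' : ℝ} (h : δ ≤ δ') : tauMod r p f δ ≤ tauMod r p f δ' := by
  rw [tauMod_eq r p f δ']
  exact tauMod_le hp hf (hf.localMod hr δ') hr fun x => localMod_mono hf r x h

/-- `τ₁(f, mδ) ≤ m τ₁(f, δ)` -/
theorem chain_one {f : ℝ → ℝ} (hf : Nice f) {δ : ℝ} (hδ : 0 < δ) (a : ℝ) (m : ℕ) :
    ∀ s t, a ≤ s → s ≤ a + m * δ → a ≤ t → t ≤ a + m * δ →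
    |f s - f t| ≤ ∑ j ∈ Finset.range m, localMod 1 f (a + j * δ + δ / 2) δ := by
  induction m with
  | zero =>
    intro s t h1 h2 h3 h4
    simp only [Nat.cast_zero, zero_mul, add_zero] at h2 h4
    have : s = t := by linarith
    simp [this]
  | succ m ih =>
    intro s t h1 h2 h3 h4
    rw [Finset.sum_range_succ]
    push_cast at h2 h4
    have hm : 0 ≤ (m:ℝ) * δ := by positivity
    have n0 := localMod_nonneg 1 f (a + m * δ + δ / 2) δ
    have n1 : 0 ≤ ∑ j ∈ Finset.range m, localMod 1 f (a + j * δ + δ / 2) δ :=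
      Finset.sum_nonneg fun i _ => localMod_nonneg _ _ _ _
    have last : ∀ s t, a + m * δ ≤ s → s ≤ a + (m + 1) * δ → a + m * δ ≤ t →
        t ≤ a + (m + 1) * δ → |f s - f t| ≤ localMod 1 f (a + m * δ + δ / 2) δ := by
      intro s t h1 h2 h3 h4
      apply le_localMod_one hf <;> rw [abs_le] <;> constructor <;> linarith
    set w := a + m * δ with hw
    rcases le_total s w with hs | hs <;> rcases le_total t w with ht | ht
    · linarith [ih s t h1 hs h3 ht]
    · have A := ih s w h1 hs (by linarith) le_rfl
      have B := last w t le_rfl (by linarith) ht h4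
      have := abs_sub_le (f s) (f w) (f t)
      linarith
    · have A := ih w t (by linarith) le_rfl h3 ht
      have B := last s w hs h2 le_rfl (by linarith)
      have := abs_sub_le (f s) (f w) (f t)
      linarith
    · linarith [last s t hs h2 ht h4]

theorem tau_one_scale {p : ℝ} (hp : 1 ≤ p) {f : ℝ → ℝ} (hf : Nice f) {δ : ℝ} (hδ : 0 < δ) (m : ℕ) :
    tauMod 1 p f (m * δ) ≤ m * tauMod 1 p f δ := by
  have hN : ∀ j ∈ Finset.range m, Nice (fun x => localMod 1 f (x + (j * δ + δ / 2 - m * δ / 2)) δ) :=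
    fun j _ => (hf.localMod one_pos δ).shift _
  refine (tauMod_le hp hf (Nice.sum (Finset.range m) _ hN) one_pos (fun x => ?_)).trans ?_
  · apply localMod_one_le (Finset.sum_nonneg fun i _ => localMod_nonneg _ _ _ _)
    intro s t hs ht
    rw [abs_le] at hs ht
    have := chain_one hf hδ (x - m * δ / 2) m s t (by linarith) (by linarith) (by linarith)
      (by linarith)
    refine this.trans (le_of_eq (Finset.sum_congr rfl fun j _ => ?_))
    congr 1
    ring
  · refine (LpNorm_sum hp _ _ hN).trans ?_
    rw [tauMod_eq]
    have : ∀ j ∈ Finset.range m,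
      LpNorm p (fun x => localMod 1 f (x + (j * δ + δ / 2 - m * δ / 2)) δ)
        = LpNorm p (fun x => localMod 1 f x δ) := fun j _ =>
      LpNorm_shift p (f := fun x => localMod 1 f x δ) (localMod_periodic 1 hf δ) _
    rw [Finset.sum_congr rfl this]
    simp


theorem second_diff_sum (f : ℝ → ℝ) (t h : ℝ) (k : ℕ) :
    f (t + 2 * (k * h)) - 2 * f (t + k * h) + f t =
      ∑ i ∈ Finset.range k, ∑ j ∈ Finset.range k,
        (f (t + (i + j : ℝ) * h + 2 * h) - 2 * f (t + (i + j : ℝ) * h + h)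
          + f (t + (i + j : ℝ) * h)) := by
  have h1 : ∀ i : ℕ, ∑ j ∈ Finset.range k,
        (f (t + (i + j : ℝ) * h + 2 * h) - 2 * f (t + (i + j : ℝ) * h + h)
          + f (t + (i + j : ℝ) * h)) =
        (f (t + (i + k : ℝ) * h + h) - f (t + (i + k : ℝ) * h))
          - (f (t + i * h + h) - f (t + i * h)) := by
    intro i
    have := Finset.sum_range_sub
      (fun j : ℕ => f (t + (i + j : ℝ) * h + h) - f (t + (i + j : ℝ) * h)) k
    simp only [Nat.cast_zero, add_zero] at this
    rw [← this]
    refine Finset.sum_congr rfl fun j _ => ?_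
    push_cast
    rw [show t + (i + (j + 1) : ℝ) * h + h = t + (i + j : ℝ) * h + 2 * h by ring,
      show t + (i + (j + 1) : ℝ) * h = t + (i + j : ℝ) * h + h by ring]
    ring
  rw [Finset.sum_congr rfl fun i _ => h1 i]
  have := Finset.sum_range_sub
      (fun i : ℕ => f (t + (i + k : ℝ) * h) - f (t + i * h)) k
  simp only [Nat.cast_zero, zero_add, zero_mul, add_zero] at this
  have e : f (t + 2 * (k * h)) - 2 * f (t + k * h) + f t =
    f (t + (k + k) * h) - f (t + k * h) - (f (t + k * h) - f t) := by
    rw [show t + (k + k) * h = t + 2 * (k * h) by ring]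
    ring
  rw [e, ← this]
  refine Finset.sum_congr rfl fun j _ => ?_
  push_cast
  rw [show t + (j + 1 + k : ℝ) * h = t + (j + k : ℝ) * h + h by ring,
      show t + (j + 1 : ℝ) * h = t + j * h + h by ring]
  ring

theorem two_scale_point {f : ℝ → ℝ} (hf : Nice f) {δ : ℝ} (hδ : 0 < δ) {m : ℕ} (hm : 0 < m)
    {x t H : ℝ} (h1 : |t - x| ≤ m * δ) (h2 : |t + 2 * H - x| ≤ m * δ) :
    |f (t + 2 * H) - 2 * f (t + H) + f t| ≤
      4 * (m:ℝ) ^ 2 * ∑ j ∈ Finset.Icc (-(m:ℤ)) m, localMod 2 f (x + j * δ) δ := by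
  have hm' : (0:ℝ) < m := by exact_mod_cast hm
  set S := ∑ j ∈ Finset.Icc (-(m:ℤ)) m, localMod 2 f (x + j * δ) δ with hS
  set h := H / (2 * m) with hh
  have hH : H = ((2 * m : ℕ) : ℝ) * h := by
    rw [hh]; push_cast; field_simp
  rw [abs_le] at h1 h2
  have hha : |h| ≤ δ / 2 := by
    rw [hh, abs_div, abs_of_pos (by positivity : (0:ℝ) < 2 * m), div_le_iff₀ (by positivity)]
    rw [abs_le]; constructor <;> nlinarith
  have hha' := abs_le.1 hha
  have term : ∀ i ∈ Finset.range (2 * m), ∀ j ∈ Finset.range (2 * m),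
      |f (t + (i + j : ℝ) * h + 2 * h) - 2 * f (t + (i + j : ℝ) * h + h)
          + f (t + (i + j : ℝ) * h)| ≤ S := by
    intro i hi j hj
    rw [Finset.mem_range] at hi hj
    set u := t + (i + j : ℝ) * h with hu
    have hs : (i + j + 1 : ℝ) ≤ 4 * m := by
      have : i + j + 1 ≤ 4 * m := by omega
      exact_mod_cast this
    have hs0 : (0:ℝ) ≤ i + j + 1 := by positivity
    have hHh : 2 * H = 4 * m * h := by rw [hH]; push_cast; ring
    rw [hHh] at h2
    have hy : |u + h - x| ≤ m * δ := by
      have e : u + h - x = t - x + (i + j + 1) * h := by rw [hu]; ring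
      rw [e, abs_le]
      rcases le_total 0 h with h0 | h0
      · constructor
        · nlinarith [mul_nonneg hs0 h0]
        · nlinarith [mul_le_mul_of_nonneg_right hs h0]
      · constructor
        · nlinarith [mul_le_mul_of_nonpos_right hs h0]
        · nlinarith [mul_nonpos_of_nonneg_of_nonpos hs0 h0]
    set z := (u + h - x) / δ with hz
    have hzz : u + h - x = z * δ := by rw [hz]; field_simp
    have hr := abs_le.1 (abs_sub_round z)
    have hzb : |z| ≤ m := by
      rw [hz, abs_div, abs_of_pos hδ, div_le_iff₀ hδ]; exact hy
    rw [abs_le] at hzb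
    have hj0 : round z ∈ Finset.Icc (-(m:ℤ)) m := by
      rw [Finset.mem_Icc]
      have a1 : ((round z : ℤ):ℝ) < m + 1 := by linarith
      have a2 : (-(m:ℝ)) - 1 < ((round z : ℤ):ℝ) := by linarith
      constructor
      · have : (-(m:ℤ)) - 1 < round z := by exact_mod_cast a2
        omega
      · have : round z < (m:ℤ) + 1 := by exact_mod_cast a1
        omega
    have le1 : localMod 2 f (x + (round z : ℤ) * δ) δ ≤ S :=
      Finset.single_le_sum (f := fun j : ℤ => localMod 2 f (x + j * δ) δ)
        (fun j _ => localMod_nonneg _ _ _ _) hj0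
    refine le_trans ?_ le1
    have b1 : z * δ - (round z : ℤ) * δ ≤ δ / 2 := by nlinarith
    have b2 : -(δ / 2) ≤ z * δ - (round z : ℤ) * δ := by nlinarith
    apply le_localMod_two hf <;> rw [abs_le] <;> constructor <;> linarith
  rw [hH, second_diff_sum f t h (2 * m)]
  refine (Finset.abs_sum_le_sum_abs _ _).trans ?_
  refine (Finset.sum_le_sum fun i hi => (Finset.abs_sum_le_sum_abs _ _).trans
    (Finset.sum_le_sum fun j hj => term i hi j hj)).trans ?_
  simp
  apply le_of_eq
  ring

theorem tau_two_scale {p : ℝ} (hp : 1 ≤ p) {f : ℝ → ℝ} (hf : Nice f) {δ : ℝ} (hδ : 0 < δ)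
    {m : ℕ} (hm : 0 < m) :
    tauMod 2 p f (m * δ) ≤ 4 * (m:ℝ) ^ 2 * (2 * m + 1) * tauMod 2 p f δ := by
  have hN : ∀ j ∈ Finset.Icc (-(m:ℤ)) m, Nice (fun x => localMod 2 f (x + j * δ) δ) :=
    fun j _ => (hf.localMod two_pos δ).shift _
  have hN2 := Nice.sum _ _ hN
  refine (tauMod_le hp hf (hN2.const_mul (4 * (m:ℝ) ^ 2)) two_pos (fun x => ?_)).trans ?_
  · apply localMod_two_le
    · exact mul_nonneg (by positivity) (Finset.sum_nonneg fun i _ => localMod_nonneg _ _ _ _)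
    · intro t h h1 h2
      exact two_scale_point hf hδ hm h1 h2
  · rw [LpNorm_const_mul hp hN2, abs_of_nonneg (by positivity), mul_assoc (4 * (m:ℝ)^2)]
    gcongr
    refine (LpNorm_sum hp _ _ hN).trans ?_
    rw [tauMod_eq]
    have : ∀ j ∈ Finset.Icc (-(m:ℤ)) m,
      LpNorm p (fun x => localMod 2 f (x + j * δ) δ)
        = LpNorm p (fun x => localMod 2 f x δ) := fun j _ =>
      LpNorm_shift p (f := fun x => localMod 2 f x δ) (localMod_periodic 2 hf δ) _
    rw [Finset.sum_congr rfl this]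
    simp only [Finset.sum_const, Int.card_Icc, nsmul_eq_mul]
    apply le_of_eq
    congr 1
    have : ((m:ℤ) + 1 - -(m:ℤ)).toNat = 2 * m + 1 := by omega
    rw [this]; push_cast; ring

/-- weighted sum of shifted local moduli -/
noncomputable def Hfun (f : ℝ → ℝ) (δ : ℝ) (R : ℕ) (x : ℝ) : ℝ :=
  ∑ j ∈ Finset.Icc (-(R:ℤ)) R, (1 / (1 + |(j:ℝ)|) ^ 2) * localMod 2 f (x + j * δ) δ

theorem Hfun_nonneg (f : ℝ → ℝ) (δ : ℝ) (R : ℕ) (x : ℝ) : 0 ≤ Hfun f δ R x :=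
  Finset.sum_nonneg fun j _ => mul_nonneg (by positivity) (localMod_nonneg _ _ _ _)

theorem Nice.Hfun {f : ℝ → ℝ} (hf : Nice f) (δ : ℝ) (R : ℕ) : Nice (Hfun f δ R) :=
  Nice.sum _ _ fun j _ => ((hf.localMod two_pos δ).shift (j * δ)).const_mul _

theorem summable_weights : Summable (fun j : ℤ => 1 / (1 + |(j:ℝ)|) ^ 2) := by
  have h := (Real.summable_one_div_int_pow (p := 2)).2 one_lt_two
  have h0 : Summable (fun j : ℤ => if j = 0 then (1:ℝ) else 0) :=
    summable_of_ne_finset_zero (s := {0}) (by intro b hb; simp at hb; simp [hb])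
  refine Summable.of_nonneg_of_le (fun j => by positivity) (fun j => ?_) (h.add h0)
  by_cases hj : j = 0
  · simp [hj]
  · simp only [hj, if_false, add_zero]
    have : (0:ℝ) < |(j:ℝ)| := by simpa using hj
    rw [← sq_abs (j:ℝ)]
    apply one_div_le_one_div_of_le (by positivity)
    nlinarith

noncomputable def wConst : ℝ := ∑' j : ℤ, 1 / (1 + |(j:ℝ)|) ^ 2

theorem LpNorm_Hfun {p : ℝ} (hp : 1 ≤ p) {f : ℝ → ℝ} (hf : Nice f) (δ : ℝ) (R : ℕ) :
    LpNorm p (Hfun f δ R) ≤ wConst * tauMod 2 p f δ := by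
  have h0 := LpNorm_sum hp (Finset.Icc (-(R:ℤ)) R)
    (fun (j : ℤ) x => (1 / (1 + |(j:ℝ)|) ^ 2) * localMod 2 f (x + j * δ) δ)
    (fun j _ => ((hf.localMod two_pos δ).shift (j * δ)).const_mul _)
  refine le_trans h0 ?_
  have : ∀ j ∈ Finset.Icc (-(R:ℤ)) R,
      LpNorm p (fun x => (1 / (1 + |(j:ℝ)|) ^ 2) * localMod 2 f (x + j * δ) δ)
        = (1 / (1 + |(j:ℝ)|) ^ 2) * tauMod 2 p f δ := fun j _ => by
    rw [LpNorm_const_mul hp ((hf.localMod two_pos δ).shift (j * δ)),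
      LpNorm_shift p (f := fun x => localMod 2 f x δ) (localMod_periodic 2 hf δ) _, tauMod_eq,
      abs_of_nonneg (by positivity)]
  rw [Finset.sum_congr rfl this, ← Finset.sum_mul]
  apply mul_le_mul_of_nonneg_right _ (tauMod_nonneg _ _ _ _)
  exact summable_weights.sum_le_tsum _ (fun j _ => by positivity)

theorem second_diff_le_Hfun {f : ℝ → ℝ} (hf : Nice f) {δ : ℝ} (hδ : 0 < δ) {m R : ℕ} (hm : 0 < m)
    (hmR : m ≤ R) {x t H : ℝ} (h1 : |t - x| ≤ m * δ) (h2 : |t + 2 * H - x| ≤ m * δ) :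
    |f (t + 2 * H) - 2 * f (t + H) + f t| ≤ 4 * ((m:ℝ) + 1) ^ 4 * Hfun f δ R x := by
  refine (two_scale_point hf hδ hm h1 h2).trans ?_
  rw [mul_assoc, mul_assoc]
  gcongr 4 * ?_
  have : Finset.Icc (-(m:ℤ)) m ⊆ Finset.Icc (-(R:ℤ)) R :=
    Finset.Icc_subset_Icc (by omega) (by omega)
  unfold Hfun
  rw [Finset.mul_sum, Finset.mul_sum]
  refine (Finset.sum_le_sum fun j hj => ?_).trans
    (Finset.sum_le_sum_of_subset_of_nonneg this fun j _ _ =>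
      mul_nonneg (by positivity) (mul_nonneg (by positivity) (localMod_nonneg _ _ _ _)))
  rw [← mul_assoc]
  apply mul_le_mul_of_nonneg_right _ (localMod_nonneg _ _ _ _)
  rw [Finset.mem_Icc] at hj
  have hj' : |(j:ℝ)| ≤ m := by
    rw [abs_le]; exact ⟨by exact_mod_cast hj.1, by exact_mod_cast hj.2⟩
  have hj0 := abs_nonneg (j:ℝ)
  rw [mul_one_div, le_div_iff₀ (by positivity)]
  have a : (1 + |(j:ℝ)|) ^ 2 ≤ ((m:ℝ) + 1) ^ 2 :=
    pow_le_pow_left₀ (by positivity) (by linarith) 2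
  have b : (m:ℝ) ^ 2 ≤ ((m:ℝ) + 1) ^ 2 := by gcongr; linarith
  calc (m:ℝ) ^ 2 * (1 + |(j:ℝ)|) ^ 2 ≤ ((m:ℝ) + 1) ^ 2 * ((m:ℝ) + 1) ^ 2 := by gcongr
    _ = _ := by ring


noncomputable def Ee (l : ℤ) (x : ℝ) : ℂ :=
  Complex.exp (2 * Real.pi * Complex.I * (l : ℂ) * (x : ℂ))

theorem Ee_add (k l : ℤ) (x : ℝ) : Ee (k + l) x = Ee k x * Ee l x := by
  unfold Ee; rw [← Complex.exp_add]; push_cast; ring_nf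

theorem Ee_sub_arg (l : ℤ) (x t : ℝ) : Ee l (x - t) = Ee l x * Ee (-l) t := by
  unfold Ee; rw [← Complex.exp_add]; push_cast; ring_nf

theorem Ee_zero (x : ℝ) : Ee 0 x = 1 := by simp [Ee]

theorem Ee_add_one (l : ℤ) (x : ℝ) : Ee l (x + 1) = Ee l x := by
  unfold Ee
  rw [Complex.exp_eq_exp_iff_exists_int]
  exact ⟨l, by push_cast; ring⟩

theorem Ee_norm (l : ℤ) (x : ℝ) : ‖Ee l x‖ = 1 := by
  unfold Ee
  rw [show (2 * Real.pi * Complex.I * (l : ℂ) * (x : ℂ)) = ((2 * Real.pi * l * x : ℝ) : ℂ) * Complex.I by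
    push_cast; ring]
  exact Complex.norm_exp_ofReal_mul_I _

theorem Ee_conj (l : ℤ) (x : ℝ) : (starRingEnd ℂ) (Ee l x) = Ee (-l) x := by
  unfold Ee
  rw [← Complex.exp_conj]
  have : (starRingEnd ℂ) 2 = 2 := Complex.conj_ofNat 2
  simp [this]

theorem Ee_continuous (l : ℤ) : Continuous (Ee l) := by
  unfold Ee; fun_prop

theorem Ee_hasDerivAt (l : ℤ) (x : ℝ) :
    HasDerivAt (Ee l) (2 * Real.pi * Complex.I * (l : ℂ) * Ee l x) x := by
  unfold Ee
  have h1 : HasDerivAt (fun x : ℝ => 2 * Real.pi * Complex.I * (l : ℂ) * (x : ℂ))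
    (2 * Real.pi * Complex.I * (l : ℂ)) x := by
    simpa using (Complex.ofRealCLM.hasDerivAt (x := x)).const_mul (2 * Real.pi * Complex.I * (l : ℂ))
  have := h1.cexp
  convert this using 1
  ring

theorem Ee_integral (l : ℤ) : ∫ t in (0:ℝ)..1, Ee l t = if l = 0 then 1 else 0 := by
  split_ifs with h
  · simp [h, Ee_zero]
  · unfold Ee
    have hc : (2 * Real.pi * Complex.I * (l : ℂ)) ≠ 0 := by
      simp [h, Real.pi_ne_zero]
    rw [integral_exp_mul_complex hc]
    have h1 := Ee_add_one l 0
    unfold Ee at h1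
    rw [zero_add] at h1
    rw [h1]; simp

def TP (n : ℕ) : Submodule ℂ (ℝ → ℂ) :=
  Submodule.span ℂ (Ee '' (Finset.Icc (-(n:ℤ)) n : Finset ℤ))

theorem Ee_mem_TP {n : ℕ} {l : ℤ} (h1 : -(n:ℤ) ≤ l) (h2 : l ≤ n) : Ee l ∈ TP n :=
  Submodule.subset_span ⟨l, by simp [h1, h2], rfl⟩

theorem TP_exists {n : ℕ} {g : ℝ → ℂ} (h : g ∈ TP n) :
    ∃ c : ℤ → ℂ, ∀ x, g x = ∑ l ∈ Finset.Icc (-(n:ℤ)) n, c l * Ee l x := by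
  unfold TP at h
  rw [Submodule.mem_span_image_finset_iff_exists_fun] at h
  obtain ⟨c, hc⟩ := h
  refine ⟨fun l => if hl : l ∈ Finset.Icc (-(n:ℤ)) n then c ⟨l, hl⟩ else 0, fun x => ?_⟩
  rw [← hc, Finset.sum_apply, ← Finset.sum_coe_sort (Finset.Icc (-(n:ℤ)) n)]
  refine Finset.sum_congr rfl fun i _ => ?_
  simp only [i.2, dif_pos, Pi.smul_apply, smul_eq_mul]

theorem TP_of_sum {n : ℕ} {g : ℝ → ℂ} (c : ℤ → ℂ)
    (h : ∀ x, g x = ∑ l ∈ Finset.Icc (-(n:ℤ)) n, c l * Ee l x) : g ∈ TP n := by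
  have : g = ∑ l ∈ Finset.Icc (-(n:ℤ)) n, c l • Ee l := by
    ext x; rw [h x]; simp [Finset.sum_apply]
  rw [this]
  refine Submodule.sum_mem _ fun l hl => Submodule.smul_mem _ _ ?_
  rw [Finset.mem_Icc] at hl
  exact Ee_mem_TP hl.1 hl.2

theorem isTrigPoly_iff {n : ℕ} {T : ℝ → ℝ} : IsTrigPoly n T ↔ (fun x => (T x : ℂ)) ∈ TP n := by
  constructor
  · rintro ⟨c, hc⟩
    exact TP_of_sum c hc
  · intro h
    obtain ⟨c, hc⟩ := TP_exists h
    exact ⟨c, hc⟩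

theorem TP_mul {m n : ℕ} {g h : ℝ → ℂ} (hg : g ∈ TP m) (hh : h ∈ TP n) :
    (fun x => g x * h x) ∈ TP (m + n) := by
  obtain ⟨c, hc⟩ := TP_exists hg
  obtain ⟨d, hd⟩ := TP_exists hh
  have : (fun x => g x * h x) = ∑ k ∈ Finset.Icc (-(m:ℤ)) m, ∑ l ∈ Finset.Icc (-(n:ℤ)) n,
      (c k * d l) • Ee (k + l) := by
    ext x
    rw [hc, hd, Finset.sum_mul_sum]
    simp only [Finset.sum_apply, Pi.smul_apply, smul_eq_mul, Ee_add]
    refine Finset.sum_congr rfl fun k _ => Finset.sum_congr rfl fun l _ => ?_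
    ring
  rw [this]
  refine Submodule.sum_mem _ fun k hk => Submodule.sum_mem _ fun l hl => Submodule.smul_mem _ _ ?_
  rw [Finset.mem_Icc] at hk hl
  apply Ee_mem_TP <;> push_cast <;> omega

theorem TP_mono {m n : ℕ} (h : m ≤ n) : TP m ≤ TP n := by
  apply Submodule.span_mono
  apply Set.image_mono
  simp only [Finset.coe_Icc]
  exact Set.Icc_subset_Icc (by omega) (by omega)

theorem IsTrigPoly.mono {m n : ℕ} (h : m ≤ n) {T : ℝ → ℝ} (hT : IsTrigPoly m T) :
    IsTrigPoly n T := by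
  rw [isTrigPoly_iff] at *
  exact TP_mono h hT

theorem IsTrigPoly.mul {m n : ℕ} {S T : ℝ → ℝ} (hS : IsTrigPoly m S) (hT : IsTrigPoly n T) :
    IsTrigPoly (m + n) (fun x => S x * T x) := by
  rw [isTrigPoly_iff] at *
  simpa using TP_mul hS hT

theorem IsTrigPoly.add {n : ℕ} {S T : ℝ → ℝ} (hS : IsTrigPoly n S) (hT : IsTrigPoly n T) :
    IsTrigPoly n (fun x => S x + T x) := by
  rw [isTrigPoly_iff] at *
  convert (TP n).add_mem hS hT using 1
  ext x; simp

theorem IsTrigPoly.const_mul {n : ℕ} {T : ℝ → ℝ} (a : ℝ) (hT : IsTrigPoly n T) :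
    IsTrigPoly n (fun x => a * T x) := by
  rw [isTrigPoly_iff] at *
  convert (TP n).smul_mem (a : ℂ) hT using 1
  ext x; simp

theorem IsTrigPoly.sub {n : ℕ} {S T : ℝ → ℝ} (hS : IsTrigPoly n S) (hT : IsTrigPoly n T) :
    IsTrigPoly n (fun x => S x - T x) := by
  convert hS.add (hT.const_mul (-1)) using 2
  ring

theorem IsTrigPoly.const (n : ℕ) (a : ℝ) : IsTrigPoly n (fun _ => a) := by
  rw [isTrigPoly_iff]
  convert (TP n).smul_mem (a : ℂ) (Ee_mem_TP (n := n) (l := 0) (by omega) (by omega)) using 1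
  ext x; simp [Ee_zero]

theorem IsTrigPoly.continuous {n : ℕ} {T : ℝ → ℝ} (hT : IsTrigPoly n T) : Continuous T := by
  obtain ⟨c, hc⟩ := hT
  have : T = fun x => (∑ l ∈ Finset.Icc (-(n:ℤ)) n, c l * Ee l x).re := by
    ext x
    have h2 : (T x : ℂ) = ∑ l ∈ Finset.Icc (-(n:ℤ)) n, c l * Ee l x := hc x
    rw [← h2]; simp
  rw [this]
  have := fun l => Ee_continuous l
  fun_prop

theorem IsTrigPoly.periodic {n : ℕ} {T : ℝ → ℝ} (hT : IsTrigPoly n T) : Function.Periodic T 1 := by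
  obtain ⟨c, hc⟩ := hT
  intro x
  have h2 : ∀ x, (T x : ℂ) = ∑ l ∈ Finset.Icc (-(n:ℤ)) n, c l * Ee l x := hc
  have : (T (x + 1) : ℂ) = T x := by
    rw [h2, h2]; simp only [Ee_add_one]
  exact_mod_cast this

theorem IsTrigPoly.nice {n : ℕ} {T : ℝ → ℝ} (hT : IsTrigPoly n T) : Nice T := by
  refine ⟨hT.periodic, hT.continuous.measurable, ?_⟩
  obtain ⟨c, hc⟩ := hT
  refine ⟨∑ l ∈ Finset.Icc (-(n:ℤ)) n, ‖c l‖, fun x => ?_⟩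
  have h2 : (T x : ℂ) = ∑ l ∈ Finset.Icc (-(n:ℤ)) n, c l * Ee l x := hc x
  have h3 : |T x| = ‖(T x : ℂ)‖ := by simp
  rw [h3, h2]
  refine (norm_sum_le _ _).trans (Finset.sum_le_sum fun l _ => ?_)
  rw [norm_mul, Ee_norm, mul_one]

/-- derivative of a trigonometric polynomial -/
theorem IsTrigPoly.exists_deriv {n : ℕ} {T : ℝ → ℝ} (c : ℤ → ℂ)
    (hc : ∀ x, (T x : ℂ) = ∑ l ∈ Finset.Icc (-(n:ℤ)) n, c l * Ee l x) :
    ∃ T' : ℝ → ℝ, IsTrigPoly n T' ∧ (∀ x, HasDerivAt T (T' x) x) ∧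
      ∀ x, (T' x : ℂ) = ∑ l ∈ Finset.Icc (-(n:ℤ)) n,
        c l * (2 * Real.pi * Complex.I * (l : ℂ) * Ee l x) := by
  set D : ℝ → ℂ := fun x => ∑ l ∈ Finset.Icc (-(n:ℤ)) n,
        c l * (2 * Real.pi * Complex.I * (l : ℂ) * Ee l x) with hD
  have hd : ∀ x, HasDerivAt (fun x => (T x : ℂ)) (D x) x := by
    intro x
    have : (fun x => (T x : ℂ)) = fun x => ∑ l ∈ Finset.Icc (-(n:ℤ)) n, c l * Ee l x := by
      ext x; exact hc x
    rw [this]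
    exact HasDerivAt.fun_sum fun l _ => (Ee_hasDerivAt l x).const_mul (c l)
  have hre : ∀ x, HasDerivAt T (D x).re x := fun x => by
    have := Complex.reCLM.hasFDerivAt.comp_hasDerivAt x (hd x)
    simpa [Function.comp_def] using this
  have him : ∀ x, (D x).im = 0 := fun x => by
    have := Complex.imCLM.hasFDerivAt.comp_hasDerivAt x (hd x)
    have h2 : HasDerivAt (fun _ : ℝ => (0:ℝ)) (D x).im x := by
      simpa [Function.comp_def] using this
    exact h2.unique (hasDerivAt_const x 0)
  have hreal : ∀ x, (((D x).re : ℝ) : ℂ) = D x := fun x => by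
    apply Complex.ext <;> simp [him x]
  refine ⟨fun x => (D x).re, ?_, hre, hreal⟩
  rw [isTrigPoly_iff]
  apply TP_of_sum (fun l => c l * (2 * Real.pi * Complex.I * (l : ℂ)))
  intro x
  rw [hreal, hD]
  exact Finset.sum_congr rfl fun l _ => by ring

/-- unnormalised Fejer kernel -/
noncomputable def Fej (M : ℕ) (t : ℝ) : ℝ := ‖∑ j ∈ Finset.range M, Ee j t‖ ^ 2

theorem Fej_nonneg (M : ℕ) (t : ℝ) : 0 ≤ Fej M t := by unfold Fej; positivity

theorem Fej_complex (M : ℕ) (t : ℝ) : (Fej M t : ℂ) =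
    ∑ j ∈ Finset.range M, ∑ k ∈ Finset.range M, Ee ((j:ℤ) - k) t := by
  unfold Fej
  rw [Complex.ofReal_pow, ← Complex.mul_conj', map_sum, Finset.sum_mul_sum]
  refine Finset.sum_congr rfl fun j _ => Finset.sum_congr rfl fun k _ => ?_
  rw [Ee_conj, ← Ee_add, sub_eq_add_neg]

theorem Fej_trig (M : ℕ) : IsTrigPoly (M - 1) (Fej M) := by
  rw [isTrigPoly_iff]
  have : (fun x => (Fej M x : ℂ)) = ∑ j ∈ Finset.range M, ∑ k ∈ Finset.range M, Ee ((j:ℤ) - k) := by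
    ext x
    rw [Fej_complex]; simp [Finset.sum_apply]
  rw [this]
  refine Submodule.sum_mem _ fun j hj => Submodule.sum_mem _ fun k hk => ?_
  rw [Finset.mem_range] at hj hk
  apply Ee_mem_TP <;> omega

theorem Fej_integral (M : ℕ) : ∫ t in (0:ℝ)..1, Fej M t = M := by
  have h : ((∫ t in (0:ℝ)..1, Fej M t : ℝ) : ℂ) = M := by
    rw [← intervalIntegral.integral_ofReal]
    simp only [Fej_complex]
    have hi : ∀ l, IntervalIntegrable (Ee l) volume 0 1 :=
      fun l => (Ee_continuous l).intervalIntegrable _ _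
    rw [intervalIntegral.integral_finsetSum]
    swap
    · intro j _
      exact (continuous_finsetSum _ fun k _ => Ee_continuous _).intervalIntegrable _ _
    have : ∀ j ∈ Finset.range M, ∫ t in (0:ℝ)..1, ∑ k ∈ Finset.range M, Ee ((j:ℤ) - k) t = 1 := by
      intro j hj
      rw [intervalIntegral.integral_finsetSum (fun k _ => hi _)]
      simp only [Ee_integral]
      have e : ∀ k : ℕ, ((j:ℤ) - k = 0) ↔ j = k := fun k => by omega
      simp only [e]
      rw [Finset.sum_ite_eq]
      simp [hj]
    rw [Finset.sum_congr rfl this]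
    simp
  exact_mod_cast h

theorem fej_mult {n : ℕ} {l : ℤ} (h1 : -(n:ℤ) ≤ l) (h2 : l ≤ n) :
    ∫ t in (0:ℝ)..1, Ee (-l) t * ((Ee n t - Ee (-n) t) * (Fej n t : ℂ)) = l := by
  have hi : ∀ l, IntervalIntegrable (Ee l) volume 0 1 :=
      fun l => (Ee_continuous l).intervalIntegrable _ _
  have e1 : ∀ t, Ee (-l) t * ((Ee n t - Ee (-n) t) * (Fej n t : ℂ)) =
      ∑ j ∈ Finset.range n, ∑ k ∈ Finset.range n,
        (Ee (j - k + n - l) t - Ee (j - k - n - l) t) := by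
    intro t
    rw [Fej_complex, ← mul_assoc, Finset.mul_sum]
    refine Finset.sum_congr rfl fun j _ => ?_
    rw [Finset.mul_sum]
    refine Finset.sum_congr rfl fun k _ => ?_
    rw [show (j - k + n - l : ℤ) = -l + n + (j - k) by ring,
      show (j - k - n - l : ℤ) = -l + -n + (j - k) by ring]
    simp only [Ee_add]
    ring
  simp only [e1]
  rw [intervalIntegral.integral_finsetSum]
  swap
  · intro j _
    exact (continuous_finsetSum _ fun k _ =>
      (Ee_continuous _).sub (Ee_continuous _)).intervalIntegrable _ _
  have e2 : ∀ j ∈ Finset.range n, ∫ t in (0:ℝ)..1, ∑ k ∈ Finset.range n,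
        (Ee (j - k + n - l) t - Ee (j - k - n - l) t) =
        (if (j:ℤ) < l then 1 else 0) - (if (n:ℤ) + l ≤ j then 1 else 0) := by
    intro j hj
    rw [Finset.mem_range] at hj
    rw [intervalIntegral.integral_finsetSum (fun k _ => (hi _).sub (hi _))]
    have e3 : ∀ k ∈ Finset.range n, ∫ t in (0:ℝ)..1, (Ee (j - k + n - l) t - Ee (j - k - n - l) t)
       = (if k = ((j + n - l : ℤ)).toNat then 1 else 0) -
         (if (n:ℤ) + l ≤ j then (if k = ((j - n - l : ℤ)).toNat then 1 else 0) else 0) := by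
      intro k hk
      rw [Finset.mem_range] at hk
      rw [intervalIntegral.integral_sub (hi _) (hi _), Ee_integral, Ee_integral]
      congr 1
      · have : ((j - k + n - l : ℤ) = 0) ↔ k = ((j + n - l : ℤ)).toNat := by omega
        simp only [this]
      · by_cases hh : (n:ℤ) + l ≤ j
        · have : ((j - k - n - l : ℤ) = 0) ↔ k = ((j - n - l : ℤ)).toNat := by omega
          simp only [this, hh, if_true]
        · have : ¬ ((j - k - n - l : ℤ) = 0) := by omega
          simp only [this, hh, if_false]
    rw [Finset.sum_congr rfl e3, Finset.sum_sub_distrib]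
    congr 1
    · rw [Finset.sum_ite_eq']
      simp only [Finset.mem_range]
      have : ((j + n - l : ℤ)).toNat < n ↔ (j:ℤ) < l := by omega
      simp only [this]
    · by_cases hh : (n:ℤ) + l ≤ j
      · simp only [hh, if_true]
        rw [Finset.sum_ite_eq']
        have : ((j - n - l : ℤ)).toNat < n := by omega
        simp [this]
      · simp [hh]
  rw [Finset.sum_congr rfl e2]
  rcases le_total 0 l with hl | hl
  · obtain ⟨a, rfl⟩ := Int.eq_ofNat_of_zero_le hl
    have e4 : ∀ j ∈ Finset.range n, ((if (j:ℤ) < (a:ℤ) then (1:ℂ) else 0) -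
        (if (n:ℤ) + a ≤ j then 1 else 0)) = if j < a then 1 else 0 := by
      intro j hj
      rw [Finset.mem_range] at hj
      have : ¬ ((n:ℤ) + a ≤ j) := by omega
      simp only [this, if_false, sub_zero, Nat.cast_lt]
    rw [Finset.sum_congr rfl e4, ← Finset.sum_filter]
    have : Finset.filter (fun j => j < a) (Finset.range n) = Finset.range a := by
      ext j; simp; omega
    rw [this]; simp
  · obtain ⟨a, ha⟩ := Int.eq_ofNat_of_zero_le (neg_nonneg.2 hl)
    have hla : l = -(a:ℤ) := by omega
    subst hla
    have e4 : ∀ j ∈ Finset.range n, ((if (j:ℤ) < (-(a:ℤ)) then (1:ℂ) else 0) -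
        (if (n:ℤ) + -a ≤ j then 1 else 0)) = - if n - a ≤ j then 1 else 0 := by
      intro j hj
      rw [Finset.mem_range] at hj
      have h5 : ¬ ((j:ℤ) < -(a:ℤ)) := by omega
      have h6 : ((n:ℤ) + -a ≤ j) ↔ n - a ≤ j := by omega
      simp only [h5, h6, if_false, zero_sub]
    rw [Finset.sum_congr rfl e4, Finset.sum_neg_distrib, ← Finset.sum_filter]
    have : Finset.filter (fun j => n - a ≤ j) (Finset.range n) = Finset.Ico (n - a) n := by
      ext j; simp; omega
    rw [this]
    have h7 : n - (n - a) = a := by omega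
    simp [h7]


theorem bernstein_point {n : ℕ} (hn : 1 ≤ n) {T T' : ℝ → ℝ} {c : ℤ → ℂ}
    (hTc : Continuous T)
    (hc : ∀ x, (T x : ℂ) = ∑ l ∈ Finset.Icc (-(n:ℤ)) n, c l * Ee l x)
    (hc' : ∀ x, (T' x : ℂ) = ∑ l ∈ Finset.Icc (-(n:ℤ)) n,
        c l * (2 * Real.pi * Complex.I * (l : ℂ) * Ee l x)) (x : ℝ) :
    |T' x| ≤ 4 * Real.pi * n * ∫ t in (0:ℝ)..1, |T (x - t)| * (Fej n t / n) := by
  have hn' : (0:ℝ) < n := by exact_mod_cast hn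
  have hF : Continuous (Fej n) := (Fej_trig n).continuous
  have hE := fun l => Ee_continuous l
  have key : (T' x : ℂ) = 2 * Real.pi * Complex.I *
      ∫ t in (0:ℝ)..1, (T (x - t) : ℂ) * ((Ee n t - Ee (-n) t) * (Fej n t : ℂ)) := by
    have e1 : ∀ t, (T (x - t) : ℂ) * ((Ee n t - Ee (-n) t) * (Fej n t : ℂ)) =
        ∑ l ∈ Finset.Icc (-(n:ℤ)) n, (c l * Ee l x) *
          (Ee (-l) t * ((Ee n t - Ee (-n) t) * (Fej n t : ℂ))) := by
      intro t
      rw [hc, Finset.sum_mul]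
      refine Finset.sum_congr rfl fun l _ => ?_
      rw [Ee_sub_arg]; ring
    simp only [e1]
    rw [intervalIntegral.integral_finsetSum]
    swap
    · intro l _
      exact Continuous.intervalIntegrable (by fun_prop) _ _
    rw [hc', Finset.mul_sum]
    refine Finset.sum_congr rfl fun l hl => ?_
    rw [Finset.mem_Icc] at hl
    rw [intervalIntegral.integral_const_mul, fej_mult hl.1 hl.2]
    ring
  have h3 : |T' x| = ‖(T' x : ℂ)‖ := by simp
  rw [h3, key, norm_mul]
  have h4 : ‖(2 * Real.pi * Complex.I : ℂ)‖ = 2 * Real.pi := by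
    simp [abs_of_pos Real.pi_pos]
  rw [h4]
  have h5 : ‖∫ t in (0:ℝ)..1, (T (x - t) : ℂ) * ((Ee n t - Ee (-n) t) * (Fej n t : ℂ))‖ ≤
      ∫ t in (0:ℝ)..1, 2 * n * (|T (x - t)| * (Fej n t / n)) := by
    apply intervalIntegral.norm_integral_le_of_norm_le zero_le_one
    · refine Eventually.of_forall fun t _ => ?_
      rw [norm_mul, norm_mul]
      have a1 : ‖Ee n t - Ee (-n) t‖ ≤ 2 := by
        refine (norm_sub_le _ _).trans ?_
        rw [Ee_norm, Ee_norm]; norm_num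
      have a2 : ‖(Fej n t : ℂ)‖ = Fej n t := by
        simp [abs_of_nonneg (Fej_nonneg n t)]
      have a3 : ‖(T (x - t) : ℂ)‖ = |T (x - t)| := by simp
      rw [a2, a3]
      calc |T (x - t)| * (‖Ee n t - Ee (-n) t‖ * Fej n t) ≤ |T (x - t)| * (2 * Fej n t) := by
            gcongr
            exact Fej_nonneg n t
        _ = _ := by field_simp
    · exact Continuous.intervalIntegrable (by fun_prop) _ _
  rw [intervalIntegral.integral_const_mul] at h5
  calc _ ≤ 2 * Real.pi * (2 * n * ∫ t in (0:ℝ)..1, |T (x - t)| * (Fej n t / n)) := by gcongr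
    _ = _ := by ring

theorem bernstein_ineq {p : ℝ} (hp : 1 ≤ p) {n : ℕ} (hn : 1 ≤ n) {T : ℝ → ℝ} (hT : IsTrigPoly n T) :
    ∃ T' : ℝ → ℝ, IsTrigPoly n T' ∧ (∀ x, HasDerivAt T (T' x) x) ∧
      LpNorm p T' ≤ 4 * Real.pi * n * LpNorm p T := by
  have hT0 := hT
  have hn' : (0:ℝ) < n := by exact_mod_cast hn
  obtain ⟨c, hc⟩ := hT
  obtain ⟨T', h1, h2, h3⟩ := IsTrigPoly.exists_deriv (n := n) (T := T) c hc
  refine ⟨T', h1, h2, ?_⟩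
  have hw : Continuous (fun t => Fej n t / n) := (Fej_trig n).continuous.div_const _
  have hw0 : ∀ t, 0 ≤ Fej n t / n := fun t => div_nonneg (Fej_nonneg n t) hn'.le
  have hw1 : ∫ t in (0:ℝ)..1, Fej n t / n = 1 := by
    rw [intervalIntegral.integral_div, Fej_integral]
    field_simp
  have hA := hT0.nice.abs
  have hN := Nice.conv zero_le_one hw hw0 hw1 hA
  have hpi := Real.pi_pos
  have := LpNorm_mono' hp h1.nice (hN.const_mul (4 * Real.pi * n))
    (fun x => bernstein_point hn hT0.continuous hc h3 x)
  refine this.trans ?_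
  rw [LpNorm_const_mul hp hN, abs_of_nonneg (by positivity)]
  gcongr
  refine (LpNorm_conv hp zero_le_one hw hw0 hw1 hA).trans ?_
  rw [LpNorm_abs]

noncomputable def CB : ℝ := 1 + 8 * Real.pi

theorem CB_ge : 1 ≤ CB := by
  have := Real.pi_pos
  unfold CB; linarith

theorem pi_le_CB : 4 * Real.pi ≤ CB := by
  have := Real.pi_pos
  unfold CB; linarith

theorem local_sup {p : ℝ} (hp : 1 ≤ p) {n : ℕ} (hn : 1 ≤ n) {δ : ℝ} (hδ : 0 < δ)
    (hδn : δ * n ≤ 1) {g : ℝ → ℝ} (hg : IsTrigPoly n g) :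
    ∃ V : ℝ → ℝ, Nice V ∧ (∀ x y, |y - x| ≤ δ → |g y| ≤ V x) ∧
      LpNorm p V ≤ CB * LpNorm p g := by
  obtain ⟨g', h1, h2, h3⟩ := bernstein_ineq hp hn hg
  have hc := h1.continuous
  have hw1 : ∫ _ in (-δ)..δ, (1 / (2 * δ)) = 1 := by
    rw [intervalIntegral.integral_const]; simp; field_simp; ring
  have hab : -δ ≤ δ := by linarith
  have hw0 : ∀ t : ℝ, 0 ≤ (fun _ : ℝ => 1 / (2 * δ)) t := fun t => by positivity
  have hA := h1.nice.abs
  have hN := Nice.conv hab continuous_const hw0 hw1 hA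
  have hL := LpNorm_conv hp hab continuous_const hw0 hw1 hA
  rw [LpNorm_abs] at hL
  refine ⟨fun x => |g x| + 2 * δ * ∫ t in (-δ)..δ, |g' (x - t)| * (1 / (2 * δ)),
    hg.nice.abs.add (hN.const_mul (2 * δ)), ?_, ?_⟩
  · intro x y hxy
    rw [abs_le] at hxy
    beta_reduce
    rw [intervalIntegral.integral_mul_const]
    have e : 2 * δ * ((∫ t in (-δ)..δ, |g' (x - t)|) * (1 / (2 * δ))) =
        ∫ t in (x - δ)..(x + δ), |g' t| := by
      have := intervalIntegral.integral_comp_sub_left (a := -δ) (b := δ) (fun t => |g' t|) x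
      rw [this, sub_neg_eq_add]; field_simp
    rw [e]
    have hFT : ∫ t in x..y, g' t = g y - g x :=
      intervalIntegral.integral_eq_sub_of_hasDerivAt (fun t _ => h2 t) (hc.intervalIntegrable _ _)
    have hb : |∫ t in x..y, g' t| ≤ ∫ t in (x - δ)..(x + δ), |g' t| := by
      have i0 : ∀ a b, IntervalIntegrable (fun t => |g' t|) volume a b :=
        fun a b => hc.abs.intervalIntegrable _ _
      rcases le_total x y with hh | hh
      · refine (intervalIntegral.abs_integral_le_integral_abs hh).trans ?_
        exact intervalIntegral.integral_mono_interval (by linarith) hh (by linarith)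
          (Eventually.of_forall fun t => abs_nonneg _) (i0 _ _)
      · rw [intervalIntegral.integral_symm, abs_neg]
        refine (intervalIntegral.abs_integral_le_integral_abs hh).trans ?_
        exact intervalIntegral.integral_mono_interval (by linarith) hh (by linarith)
          (Eventually.of_forall fun t => abs_nonneg _) (i0 _ _)
    rw [hFT] at hb
    have := abs_sub_abs_le_abs_sub (g y) (g x)
    linarith
  · refine (LpNorm_add hp hg.nice.abs (hN.const_mul (2 * δ))).trans ?_
    rw [LpNorm_abs, LpNorm_const_mul hp hN, abs_of_nonneg (by positivity)]
    have n0 := LpNorm_nonneg p g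
    have hpi := Real.pi_pos
    have : 2 * δ * LpNorm p (fun x => ∫ t in (-δ)..δ, |g' (x - t)| * (1 / (2 * δ))) ≤
        8 * Real.pi * LpNorm p g := by
      calc _ ≤ 2 * δ * (4 * Real.pi * n * LpNorm p g) := by gcongr; exact hL.trans h3
        _ = (δ * n) * (8 * Real.pi * LpNorm p g) := by ring
        _ ≤ 1 * (8 * Real.pi * LpNorm p g) := by gcongr
        _ = _ := by ring
    unfold CB
    linarith

/-- mean value bound for second differences -/
theorem mvt_one {g g' : ℝ → ℝ} (h : ∀ x, HasDerivAt g (g' x) x) {x δ W : ℝ}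
    (hW : ∀ y, |y - x| ≤ δ → |g' y| ≤ W) {s t : ℝ} (hs : |s - x| ≤ δ) (ht : |t - x| ≤ δ) :
    |g s - g t| ≤ W * |s - t| := by
  have hconv : Convex ℝ (Metric.closedBall x δ) := convex_closedBall x δ
  have := hconv.norm_image_sub_le_of_norm_hasDerivWithin_le (f := g) (f' := g') (C := W)
    (fun y _ => (h y).hasDerivWithinAt)
    (fun y hy => by
      rw [Metric.mem_closedBall, Real.dist_eq] at hy
      simpa using hW y hy)
    (x := t) (y := s) (by simpa [Real.dist_eq] using ht) (by simpa [Real.dist_eq] using hs)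
  simpa using this

theorem mvt_two {g g' g'' : ℝ → ℝ} (h : ∀ x, HasDerivAt g (g' x) x)
    (h' : ∀ x, HasDerivAt g' (g'' x) x) {x δ W : ℝ}
    (hW : ∀ y, |y - x| ≤ δ → |g'' y| ≤ W) {t k : ℝ} (h1 : |t - x| ≤ δ)
    (h2 : |t + 2 * k - x| ≤ δ) :
    |g (t + 2 * k) - 2 * g (t + k) + g t| ≤ W * δ ^ 2 := by
  have a1 := abs_le.1 h1
  have a2 := abs_le.1 h2
  have hδ : 0 ≤ δ := (abs_nonneg _).trans h1
  have hW0 : 0 ≤ W := (abs_nonneg _).trans (hW x (by simpa using hδ))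
  have hk : |k| ≤ δ := by rw [abs_le]; constructor <;> linarith
  have h3 : |t + k - x| ≤ δ := by rw [abs_le]; constructor <;> linarith
  have hF : ∀ u, HasDerivAt (fun u => g (u + k) - g u) (g' (u + k) - g' u) u := fun u =>
    ((h (u + k)).comp_add_const u k).sub (h u)
  have hconv : Convex ℝ (Metric.closedBall x δ ∩ {u | u + k ∈ Metric.closedBall x δ}) := by
    apply (convex_closedBall x δ).inter
    exact (convex_closedBall x δ).translate_preimage_left k
  have := hconv.norm_image_sub_le_of_norm_hasDerivWithin_le (f := fun u => g (u + k) - g u)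
    (f' := fun u => g' (u + k) - g' u) (C := W * δ)
    (fun y _ => (hF y).hasDerivWithinAt)
    (fun y hy => by
      have y1 := hy.1
      have y2 : y + k ∈ Metric.closedBall x δ := hy.2
      rw [Metric.mem_closedBall, Real.dist_eq] at y1 y2
      have := mvt_one h' hW y2 y1
      rw [add_sub_cancel_left] at this
      rw [Real.norm_eq_abs]
      exact this.trans (by gcongr))
    (x := t) (y := t + k)
    ⟨by simpa [Real.dist_eq] using h1, by simpa [Real.dist_eq] using h3⟩
    ⟨by simpa [Real.dist_eq] using h3, by
      show t + k + k ∈ Metric.closedBall x δ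
      rw [show t + k + k = t + 2 * k by ring]
      simpa [Real.dist_eq] using h2⟩
  rw [add_sub_cancel_left, Real.norm_eq_abs, Real.norm_eq_abs] at this
  rw [show t + k + k = t + 2 * k by ring] at this
  calc _ = |g (t + 2 * k) - g (t + k) - (g (t + k) - g t)| := by congr 1; ring
    _ ≤ W * δ * |k| := this
    _ ≤ W * δ * δ := by gcongr
    _ = _ := by ring


theorem stechkin {p : ℝ} (hp : 1 ≤ p) {n : ℕ} (hn : 1 ≤ n) {q q' : ℝ → ℝ} (hq : IsTrigPoly n q)
    (hq' : IsTrigPoly n q') (hd : ∀ x, HasDerivAt q (q' x) x) {h : ℝ}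
    (hh : h = 1 / (2 * CB ^ 2 * n)) :
    LpNorm p q' ≤ 4 * CB ^ 2 * n * LpNorm p (fun x => q (x + h) - q x) := by
  have hn' : (0:ℝ) < n := by exact_mod_cast hn
  have hC := CB_ge
  have hh0 : 0 < h := by rw [hh]; positivity
  have hhn : h * n * CB ^ 2 = 1 / 2 := by
    rw [hh]; field_simp
  have hhn1 : h * n ≤ 1 := by
    have : h * n * 1 ≤ h * n * CB ^ 2 := by gcongr; nlinarith
    linarith
  obtain ⟨q'', h1, h2, h3⟩ := bernstein_ineq hp hn hq'
  obtain ⟨V, hV, hVb, hVn⟩ := local_sup hp hn hh0 hhn1 h1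
  have n0 := LpNorm_nonneg p q'
  have h3' : LpNorm p q'' ≤ CB * n * LpNorm p q' := by
    refine h3.trans ?_
    gcongr
    exact pi_le_CB
  have hD : Nice (fun x => |q (x + h) - q x|) := ((hq.nice.shift h).sub hq.nice).abs
  have pt : ∀ x, |h * q' x| ≤ |q (x + h) - q x| + h ^ 2 * V x := by
    intro x
    have hG : ∀ u, HasDerivAt (fun u => q u - u * q' x) (q' u - q' x) u := fun u => by
      have := (hd u).sub ((hasDerivAt_id u).mul_const (q' x))
      rw [one_mul] at this
      exact this
    have hb : ∀ y, |y - x| ≤ h → |q' y - q' x| ≤ V x * h := fun y hy => by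
      have := mvt_one h2 (x := x) (δ := h) (fun z hz => hVb x z hz) hy (t := x) (by simp [hh0.le])
      have V0 : 0 ≤ V x := (abs_nonneg _).trans (hVb x x (by simp [hh0.le]))
      exact this.trans (by gcongr)
    have := mvt_one hG (x := x) (δ := h) hb (s := x + h) (t := x)
      (by simp [abs_of_pos hh0]) (by simp [hh0.le])
    simp only [add_sub_cancel_left, abs_of_pos hh0] at this
    have e : h * q' x = (q (x + h) - q x) - (q (x + h) - (x + h) * q' x - (q x - x * q' x)) := by
      ring
    rw [e]
    refine (abs_sub _ _).trans ?_
    nlinarith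
  have a := LpNorm_mono' hp (hq'.nice.const_mul h) (hD.add (hV.const_mul (h ^ 2))) pt
  have b := LpNorm_add hp hD (hV.const_mul (h ^ 2))
  rw [LpNorm_const_mul hp hq'.nice, abs_of_pos hh0] at a
  rw [LpNorm_const_mul hp hV, abs_of_pos (by positivity : 0 < h ^ 2), LpNorm_abs] at b
  set D := LpNorm p (fun x => q (x + h) - q x) with hDdef
  have c : h ^ 2 * LpNorm p V ≤ h * (1 / 2) * LpNorm p q' := by
    calc h ^ 2 * LpNorm p V ≤ h ^ 2 * (CB * (CB * n * LpNorm p q')) := by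
          gcongr; exact hVn.trans (by gcongr)
      _ = h * (h * n * CB ^ 2) * LpNorm p q' := by ring
      _ = _ := by rw [hhn]
  have d : h * LpNorm p q' ≤ 2 * D := by linarith
  have e : 4 * CB ^ 2 * n * D = (2 * CB ^ 2 * n) * (2 * D) := by ring
  rw [e]
  calc LpNorm p q' = (2 * CB ^ 2 * n) * (h * LpNorm p q') := by
        rw [hh]; field_simp
    _ ≤ _ := by gcongr

theorem inverse_key {p : ℝ} (hp : 1 ≤ p) {n : ℕ} (hn : 1 ≤ n) {f Q q : ℝ → ℝ} (hf : Nice f)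
    (hQ : IsTrigPoly n Q) (hq : IsTrigPoly n q) (hfb : ∀ x, q x ≤ f x ∧ f x ≤ Q x) {m : ℕ}
    (hm : 1 ≤ m) :
    tauMod 2 p f (1 / (m * n)) ≤ (1 / (m:ℝ) ^ 2) * (4 * CB ^ 4) * tauMod 1 p f (1 / n) +
      (8 * CB ^ 4 + 4 * CB) * LpNorm p (fun x => Q x - q x) := by
  have hn' : (0:ℝ) < n := by exact_mod_cast hn
  have hm' : (1:ℝ) ≤ m := by exact_mod_cast hm
  have hC := CB_ge
  obtain ⟨q', hq', hd, hb⟩ := bernstein_ineq hp hn hq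
  obtain ⟨q'', hq'', hd', hb'⟩ := bernstein_ineq hp hn hq'
  set δ : ℝ := 1 / (m * n) with hδ
  have hδ0 : 0 < δ := by rw [hδ]; positivity
  have hδn : δ * n = 1 / m := by rw [hδ]; field_simp
  have hδn1 : δ * n ≤ 1 := by
    rw [hδn, div_le_one (by positivity)]; exact hm'
  have hg : IsTrigPoly n (fun x => Q x - q x) := hQ.sub hq
  obtain ⟨V, hV, hVb, hVn⟩ := local_sup hp hn hδ0 hδn1 hq''
  obtain ⟨U, hU, hUb, hUn⟩ := local_sup hp hn hδ0 hδn1 hg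
  set g := fun x => Q x - q x with hgdef
  have hfg : ∀ x, 0 ≤ f x - q x ∧ f x - q x ≤ |g x| := fun x => by
    have := hfb x
    refine ⟨by linarith, le_trans ?_ (le_abs_self _)⟩
    simp only [hgdef]; linarith
  have A : tauMod 2 p f δ ≤ δ ^ 2 * LpNorm p V + 4 * LpNorm p U := by
    have e := LpNorm_add hp (hV.const_mul (δ ^ 2)) (hU.const_mul 4)
    rw [LpNorm_const_mul hp hV, LpNorm_const_mul hp hU, abs_of_pos (by positivity : 0 < δ ^ 2),
      abs_of_pos (by norm_num : (0:ℝ) < 4)] at e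
    refine le_trans ?_ e
    apply tauMod_le hp hf ((hV.const_mul (δ ^ 2)).add (hU.const_mul 4)) two_pos
    intro x
    have V0 : 0 ≤ V x := (abs_nonneg _).trans (hVb x x (by simp [hδ0.le]))
    have U0 : 0 ≤ U x := (abs_nonneg _).trans (hUb x x (by simp [hδ0.le]))
    apply localMod_two_le (by positivity)
    intro t k h1 h2
    have m2 := mvt_two hd hd' (x := x) (δ := δ) (fun y hy => hVb x y hy) h1 h2
    have a1 := abs_le.1 h1
    have a2 := abs_le.1 h2
    have h3 : |t + k - x| ≤ δ := by rw [abs_le]; constructor <;> linarith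
    have b1 := hUb x t h1
    have b2 := hUb x _ h2
    have b3 := hUb x _ h3
    have c1 := hfg t
    have c2 := hfg (t + 2 * k)
    have c3 := hfg (t + k)
    rw [abs_le] at m2 ⊢
    constructor <;> linarith
  set h : ℝ := 1 / (2 * CB ^ 2 * n) with hh
  have hst := stechkin hp hn hq hq' hd hh
  have hh0 : 0 < h := by rw [hh]; positivity
  have hh1 : h ≤ 1 / n / 2 := by
    rw [hh, div_div]
    apply one_div_le_one_div_of_le (by positivity)
    have h1 : 1 ≤ CB ^ 2 := by nlinarith
    nlinarith
  have B : LpNorm p (fun x => q (x + h) - q x) ≤ tauMod 1 p f (1 / n) + 2 * LpNorm p g := by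
    have n1 := hf.localMod one_pos (1 / n : ℝ)
    have n2 := hg.nice.abs
    have n3 := n2.shift h
    have e1 := LpNorm_add hp n1 (n2.add n3)
    have e2 := LpNorm_add hp n2 n3
    rw [LpNorm_shift p n2.1, LpNorm_abs] at e2
    rw [← tauMod_eq] at e1
    have e3 : LpNorm p (fun x => q (x + h) - q x) ≤ LpNorm p
        (fun x => localMod 1 f x (1 / n) + (|g x| + |g (x + h)|)) := by
      apply LpNorm_mono' hp ((hq.nice.shift h).sub hq.nice) (n1.add (n2.add n3))
      intro x
      have l := le_localMod_one hf (x := x) (δ := 1 / n) (s := x + h) (t := x)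
        (by rw [add_sub_cancel_left, abs_of_pos hh0]; exact hh1) (by rw [sub_self, abs_zero]; positivity)
      have c1 := hfg x
      have c2 := hfg (x + h)
      rw [abs_le] at l ⊢
      constructor <;> linarith
    linarith
  have n0 := LpNorm_nonneg p g
  have t0 := tauMod_nonneg 1 p f (1 / n)
  set N := LpNorm p g
  set τ := tauMod 1 p f (1 / n)
  have hm2 : 1 / (m:ℝ) ^ 2 ≤ 1 := by
    rw [div_le_one (by positivity)]; nlinarith
  have hbb : LpNorm p q'' ≤ CB * n * (4 * CB ^ 2 * n * (τ + 2 * N)) := by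
    refine hb'.trans ?_
    gcongr
    · exact LpNorm_nonneg _ _
    · exact pi_le_CB
    · exact hst.trans (mul_le_mul_of_nonneg_left B (by positivity))
  calc tauMod 2 p f δ ≤ δ ^ 2 * LpNorm p V + 4 * LpNorm p U := A
    _ ≤ δ ^ 2 * (CB * (CB * n * (4 * CB ^ 2 * n * (τ + 2 * N)))) + 4 * (CB * N) := by
        gcongr
        exact hVn.trans (by gcongr)
    _ = (δ * n) ^ 2 * (4 * CB ^ 4) * (τ + 2 * N) + 4 * CB * N := by ring
    _ = (1 / (m:ℝ) ^ 2) * (4 * CB ^ 4) * τ + (1 / (m:ℝ) ^ 2) * (8 * CB ^ 4 * N) + 4 * CB * N := by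
        rw [hδn, div_pow, one_pow]; ring
    _ ≤ (1 / (m:ℝ) ^ 2) * (4 * CB ^ 4) * τ + 1 * (8 * CB ^ 4 * N) + 4 * CB * N := by gcongr
    _ = _ := by ring

theorem tildeE_nonempty {p : ℝ} {n : ℕ} {f : ℝ → ℝ} (hf : Nice f) :
    {y | ∃ Q q : ℝ → ℝ, IsTrigPoly n Q ∧ IsTrigPoly n q ∧
    (∀ x, q x ≤ f x ∧ f x ≤ Q x) ∧ y = LpNorm p (fun x => Q x - q x)}.Nonempty := by
  obtain ⟨-, -, M, hM⟩ := hf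
  exact ⟨_, fun _ => M, fun _ => -M, IsTrigPoly.const n M, IsTrigPoly.const n (-M),
    fun x => abs_le.1 (hM x), rfl⟩

theorem backward {p : ℝ} (hp : 1 ≤ p) {f : ℝ → ℝ} (hf : Nice f)
    (H : ∃ F : ℝ, 0 < F ∧ ∀ δ : ℝ, 0 < δ → tauMod 1 p f δ ≤ F * tauMod 2 p f δ) :
    ∃ G : ℝ, 0 < G ∧ ∀ n : ℕ, 1 ≤ n → tauMod 1 p f (1 / (n : ℝ)) ≤ G * tildeE n p f := by
  obtain ⟨F, hF, H⟩ := H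
  have hC := CB_ge
  obtain ⟨m, hm⟩ := exists_nat_ge (2 * F * (4 * CB ^ 4))
  have hm0 : (0:ℝ) < m := lt_of_lt_of_le (by positivity) hm
  have hm1 : 1 ≤ m := by
    have : 0 < m := by exact_mod_cast hm0
    omega
  set G := 2 * (m * F * (8 * CB ^ 4 + 4 * CB)) with hG
  have hG0 : 0 < G := by positivity
  refine ⟨G, hG0, fun n hn => ?_⟩
  have hn' : (0:ℝ) < n := by exact_mod_cast hn
  rw [← div_le_iff₀' hG0]
  apply le_csInf (tildeE_nonempty hf)
  rintro y ⟨Q, q, hQ, hq, hb, rfl⟩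
  rw [div_le_iff₀' hG0]
  have k := inverse_key hp hn hf hQ hq hb hm1
  have hδ : (0:ℝ) < 1 / (m * n) := by positivity
  have a := tau_one_scale hp hf hδ m
  have b := H _ hδ
  have e : (m:ℝ) * (1 / (m * n)) = 1 / n := by field_simp
  rw [e] at a
  set τ := tauMod 1 p f (1 / n)
  have t0 : 0 ≤ τ := tauMod_nonneg _ _ _ _
  set N := LpNorm p (fun x => Q x - q x)
  have c : τ ≤ m * (F * ((1 / (m:ℝ) ^ 2) * (4 * CB ^ 4) * τ + (8 * CB ^ 4 + 4 * CB) * N)) := by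
    refine a.trans ?_
    gcongr
    exact b.trans (by gcongr)
  have d : m * (F * ((1 / (m:ℝ) ^ 2) * (4 * CB ^ 4) * τ + (8 * CB ^ 4 + 4 * CB) * N)) =
     (F * (4 * CB ^ 4) / m) * τ + (G / 2) * N := by
    rw [hG]; field_simp
  have e : F * (4 * CB ^ 4) / m ≤ 1 / 2 := by
    rw [div_le_iff₀ hm0]; linarith
  have f : (F * (4 * CB ^ 4) / m) * τ ≤ 1 / 2 * τ := by gcongr
  linarith


theorem ii_mul {g w : ℝ → ℝ} (hg : Measurable g) {K : ℝ} (hb : ∀ x, |g x| ≤ K)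
    (hw : Continuous w) (a b : ℝ) : IntervalIntegrable (fun t => g t * w t) volume a b := by
  rw [intervalIntegrable_iff]
  exact (intervalIntegrable_iff.1 (hw.intervalIntegrable a b)).bdd_mul
    hg.aestronglyMeasurable (Eventually.of_forall fun x => by simpa using hb x)

theorem ii_mulC {g : ℝ → ℝ} {w : ℝ → ℂ} (hg : Measurable g) {K : ℝ} (hb : ∀ x, |g x| ≤ K)
    (hw : Continuous w) (a b : ℝ) : IntervalIntegrable (fun t => (g t : ℂ) * w t) volume a b := by
  rw [intervalIntegrable_iff]
  exact (intervalIntegrable_iff.1 (hw.intervalIntegrable a b)).bdd_mul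
    (Complex.measurable_ofReal.comp hg).aestronglyMeasurable
    (Eventually.of_forall fun x => by simpa using hb x)

theorem conv_trig {n : ℕ} {J : ℝ → ℝ} (hJ : IsTrigPoly n J) {f : ℝ → ℝ} (hf : Nice f) :
    IsTrigPoly n (fun x => ∫ t in (-(1/2))..(1/2), f (x - t) * J t) := by
  have hJp := hJ.periodic
  obtain ⟨c, hc⟩ := hJ
  obtain ⟨p1, m1, K, b1⟩ := hf
  refine ⟨fun l => c l * ∫ s in (0:ℝ)..1, (f s : ℂ) * Ee (-l) s, fun x => ?_⟩
  have hc' : ∀ x, (J x : ℂ) = ∑ l ∈ Finset.Icc (-(n:ℤ)) n, c l * Ee l x := hc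
  have h1 : ∫ t in (-(1/2) : ℝ)..(1/2), f (x - t) * J t = ∫ s in (0:ℝ)..1, f s * J (x - s) := by
    have a := intervalIntegral.integral_comp_sub_left (a := -(1/2)) (b := 1/2)
      (fun s => f s * J (x - s)) x
    simp only [sub_sub_cancel] at a
    rw [a]
    have hper : Function.Periodic (fun s => f s * J (x - s)) 1 := fun s => by
      have := hJp (x - (s + 1))
      rw [show x - (s + 1) + 1 = x - s by ring] at this
      simp only [p1 s, this]
    have b := hper.intervalIntegral_add_eq (x - 1/2) 0
    rw [zero_add] at b
    rw [← b]
    congr 1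
    ring
  simp only [h1]
  rw [← intervalIntegral.integral_ofReal]
  have e1 : ∀ s, ((f s * J (x - s) : ℝ) : ℂ) =
      ∑ l ∈ Finset.Icc (-(n:ℤ)) n, (c l * Ee l x) * ((f s : ℂ) * Ee (-l) s) := fun s => by
    push_cast
    rw [hc', Finset.mul_sum]
    refine Finset.sum_congr rfl fun l _ => ?_
    rw [Ee_sub_arg]; ring
  simp only [e1]
  rw [intervalIntegral.integral_finsetSum]
  · refine Finset.sum_congr rfl fun l hl => ?_
    rw [intervalIntegral.integral_const_mul]
    unfold Ee
    ring
  · intro l _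
    exact (ii_mulC m1 b1 (Ee_continuous (-l)) _ _).const_mul _

theorem Fej_even (M : ℕ) (t : ℝ) : Fej M (-t) = Fej M t := by
  unfold Fej
  congr 1
  rw [← RCLike.norm_conj (∑ j ∈ Finset.range M, Ee j t), map_sum]
  congr 1
  refine Finset.sum_congr rfl fun j _ => ?_
  rw [Ee_conj]
  unfold Ee; push_cast; ring_nf

theorem Ee_pow (j : ℕ) (t : ℝ) : Ee j t = (Ee 1 t) ^ j := by
  unfold Ee
  rw [← Complex.exp_nat_mul]
  push_cast; ring_nf

theorem Fej_upper_aux (M : ℕ) {t : ℝ} (h0 : 0 ≤ t) (h1 : t ≤ 1 / 2) : t ^ 2 * Fej M t ≤ 1 / 4 := by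
  have e1 : (∑ j ∈ Finset.range M, Ee j t) * (Ee 1 t - 1) = Ee M t - 1 := by
    simp only [Ee_pow]
    exact geom_sum_mul _ _
  have e2 := congrArg norm e1
  rw [norm_mul] at e2
  have e3 : ‖Ee M t - 1‖ ≤ 2 := by
    refine (norm_sub_le _ _).trans ?_
    rw [Ee_norm]; norm_num
  have e4 : ‖Ee 1 t - 1‖ = ‖2 * Real.sin (2 * Real.pi * t / 2)‖ := by
    rw [← Complex.norm_exp_I_mul_ofReal_sub_one]
    unfold Ee
    congr 3
    push_cast; ring
  have hpi := Real.pi_pos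
  have e5 : 2 * t ≤ Real.sin (Real.pi * t) := by
    have := Real.mul_le_sin (x := Real.pi * t) (by positivity) (by nlinarith)
    rwa [show 2 / Real.pi * (Real.pi * t) = 2 * t by field_simp] at this
  have e6 : 4 * t ≤ ‖Ee 1 t - 1‖ := by
    rw [e4, show 2 * Real.pi * t / 2 = Real.pi * t by ring]
    refine le_trans ?_ (le_abs_self _)
    linarith
  set S := ‖∑ j ∈ Finset.range M, Ee j t‖ with hS
  have S0 : 0 ≤ S := norm_nonneg _
  have e7 : S * (4 * t) ≤ 2 := (mul_le_mul_of_nonneg_left e6 S0).trans (by linarith)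
  have e8 : 0 ≤ S * (4 * t) := by positivity
  unfold Fej
  rw [← hS]
  nlinarith

theorem Fej_upper (M : ℕ) {t : ℝ} (h : |t| ≤ 1 / 2) : t ^ 2 * Fej M t ≤ 1 / 4 := by
  rcases abs_cases t with ⟨h1, h2⟩ | ⟨h1, h2⟩
  · exact Fej_upper_aux M h2 (by linarith)
  · have := Fej_upper_aux M (t := -t) (by linarith) (by linarith)
    rwa [Fej_even, neg_sq] at this

theorem Fej_lower {M : ℕ} (hM : 1 ≤ M) {t : ℝ} (h : |t| ≤ 1 / (8 * M)) :
    (M:ℝ) ^ 2 / 4 ≤ Fej M t := by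
  have hM' : (0:ℝ) < M := by exact_mod_cast hM
  have a1 : (M:ℝ) / 2 ≤ ‖∑ j ∈ Finset.range M, Ee j t‖ := by
    refine le_trans ?_ (Complex.re_le_norm _)
    rw [Complex.re_sum]
    have : ∀ j ∈ Finset.range M, (1 / 2 : ℝ) ≤ (Ee j t).re := by
      intro j hj
      rw [Finset.mem_range] at hj
      have hj' : (j:ℝ) ≤ M := by exact_mod_cast hj.le
      have e : (Ee j t).re = Real.cos (2 * Real.pi * j * t) := by
        unfold Ee
        rw [show (2 * Real.pi * Complex.I * ((j:ℤ) : ℂ) * (t : ℂ)) =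
          ((2 * Real.pi * j * t : ℝ) : ℂ) * Complex.I by push_cast; ring]
        exact Complex.exp_ofReal_mul_I_re _
      rw [e]
      refine le_trans ?_ Real.one_sub_sq_div_two_le_cos
      have hx : |2 * Real.pi * j * t| ≤ 1 := by
        have hpi := Real.pi_pos
        have hpi4 := Real.pi_le_four
        rw [abs_mul, abs_of_nonneg (by positivity : 0 ≤ 2 * Real.pi * j)]
        calc 2 * Real.pi * j * |t| ≤ 2 * 4 * M * (1 / (8 * M)) := by gcongr
          _ = 1 := by field_simp; norm_num
      have : (2 * Real.pi * j * t) ^ 2 ≤ 1 := by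
        rw [← sq_abs]; exact pow_le_one₀ (abs_nonneg _) hx
      linarith
    have := Finset.sum_le_sum this
    simp only [Finset.sum_const, Finset.card_range, nsmul_eq_mul] at this
    linarith
  unfold Fej
  nlinarith

theorem jackson_kernel {M : ℕ} (hM : 1 ≤ M) :
    ∃ J : ℝ → ℝ, IsTrigPoly (3 * (M - 1)) J ∧ (∀ t, 0 ≤ J t) ∧ (∀ t, J (-t) = J t) ∧
      (∫ t in (-(1/2) : ℝ)..(1/2), J t) = 1 ∧
      (∫ t in (-(1/2) : ℝ)..(1/2), (M * t) ^ 4 * J t) ≤ 16 := by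
  have hM' : (0:ℝ) < M := by exact_mod_cast hM
  have hM1 : (1:ℝ) ≤ M := by exact_mod_cast hM
  have hF := Fej_trig M
  have hFc := hF.continuous
  have hJ0 : IsTrigPoly (3 * (M - 1)) (fun t => Fej M t ^ 3) := by
    have := (hF.mul hF).mul hF
    refine IsTrigPoly.mono (by omega) ?_ (m := M - 1 + (M - 1) + (M - 1))
    convert this using 2
    ring
  have hJc : Continuous (fun t => Fej M t ^ 3) := hFc.pow 3
  set I := ∫ t in (-(1/2) : ℝ)..(1/2), Fej M t ^ 3 with hI
  have hfi : ∫ t in (-(1/2) : ℝ)..(1/2), Fej M t = M := by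
    rw [← Fej_integral M]
    have b := hF.periodic.intervalIntegral_add_eq (-(1/2)) 0
    rw [zero_add] at b
    rw [← b]; congr 1; norm_num
  have hlow : (M:ℝ) ^ 5 / 256 ≤ I := by
    have d0 : (0:ℝ) < 1 / (8 * M) := by positivity
    have d1 : (1:ℝ) / (8 * M) ≤ 1 / 2 := one_div_le_one_div_of_le two_pos (by linarith)
    calc (M:ℝ) ^ 5 / 256 = ∫ _ in (-(1 / (8 * M)) : ℝ)..(1 / (8 * M)), ((M:ℝ) ^ 2 / 4) ^ 3 := by
          rw [intervalIntegral.integral_const, smul_eq_mul]; field_simp; norm_num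
      _ ≤ ∫ t in (-(1 / (8 * M)) : ℝ)..(1 / (8 * M)), Fej M t ^ 3 := by
          apply intervalIntegral.integral_mono_on (by linarith)
            (continuous_const.intervalIntegrable _ _) (hJc.intervalIntegrable _ _)
          intro t ht
          have := Fej_lower hM (t := t) (abs_le.2 ht)
          gcongr
      _ ≤ I := by
          apply intervalIntegral.integral_mono_interval (by linarith) (by linarith) (by linarith)
            (Eventually.of_forall fun t => pow_nonneg (Fej_nonneg M t) 3)
            (hJc.intervalIntegrable _ _)
  have hI0 : 0 < I := lt_of_lt_of_le (by positivity) hlow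
  have hup : ∫ t in (-(1/2) : ℝ)..(1/2), t ^ 4 * Fej M t ^ 3 ≤ M / 16 := by
    calc ∫ t in (-(1/2) : ℝ)..(1/2), t ^ 4 * Fej M t ^ 3
        ≤ ∫ t in (-(1/2) : ℝ)..(1/2), Fej M t * (1 / 16) := by
          apply intervalIntegral.integral_mono_on (by norm_num)
            (Continuous.intervalIntegrable (by fun_prop) _ _)
            (Continuous.intervalIntegrable (by fun_prop) _ _)
          intro t ht
          have h1 := Fej_upper M (t := t) (abs_le.2 ht)
          have h0 := Fej_nonneg M t
          have h2 : (t ^ 2 * Fej M t) ^ 2 ≤ (1 / 4) ^ 2 := by gcongr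
          calc t ^ 4 * Fej M t ^ 3 = Fej M t * (t ^ 2 * Fej M t) ^ 2 := by ring
            _ ≤ Fej M t * (1 / 4) ^ 2 := by gcongr
            _ = _ := by norm_num
      _ = _ := by rw [intervalIntegral.integral_mul_const, hfi]; ring
  refine ⟨fun t => I⁻¹ * Fej M t ^ 3, hJ0.const_mul _, ?_, ?_, ?_, ?_⟩
  · intro t; have := Fej_nonneg M t; positivity
  · intro t; simp only [Fej_even]
  · rw [intervalIntegral.integral_const_mul, ← hI]; field_simp
  · have e : ∀ t : ℝ, (M * t) ^ 4 * (I⁻¹ * Fej M t ^ 3) =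
        (M ^ 4 * I⁻¹) * (t ^ 4 * Fej M t ^ 3) := fun t => by ring
    simp only [e]
    rw [intervalIntegral.integral_const_mul]
    calc _ ≤ (M ^ 4 * I⁻¹) * ((M:ℝ) / 16) := by gcongr
      _ = (M:ℝ) ^ 5 / 16 / I := by field_simp
      _ ≤ 16 := by rw [div_le_iff₀ hI0]; linarith


theorem conv_err {M : ℕ} (hM : 1 ≤ M) {J f : ℝ → ℝ} (hf : Nice f) (hJc : Continuous J)
    (hJ0 : ∀ t, 0 ≤ J t) (hJe : ∀ t, J (-t) = J t)
    (hJ1 : (∫ t in (-(1/2) : ℝ)..(1/2), J t) = 1)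
    (hJm : (∫ t in (-(1/2) : ℝ)..(1/2), (M * t) ^ 4 * J t) ≤ 16) {x y : ℝ}
    (hxy : |y - x| ≤ 3 * (1 / M)) :
    |(∫ t in (-(1/2) : ℝ)..(1/2), f (y - t) * J t) - f y| ≤ 10256 * Hfun f (1 / M) (M + 4) x := by
  have hM' : (0:ℝ) < M := by exact_mod_cast hM
  have hH := Hfun_nonneg f (1 / M) (M + 4) x
  set H := Hfun f (1 / M) (M + 4) x
  obtain ⟨p1, m1, K, b1⟩ := id hf
  have i1 : IntervalIntegrable (fun t => f (y - t) * J t) volume (-(1/2)) (1/2) :=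
    ii_mul (m1.comp (measurable_const.sub measurable_id)) (fun t => b1 _) hJc _ _
  have i2 : IntervalIntegrable (fun t => f (y + t) * J t) volume (-(1/2)) (1/2) :=
    ii_mul (m1.comp (measurable_const.add measurable_id)) (fun t => b1 _) hJc _ _
  have i3 : IntervalIntegrable (fun t => 2 * f y * J t) volume (-(1/2)) (1/2) :=
    (hJc.intervalIntegrable _ _).const_mul _
  have e1 : ∫ t in (-(1/2) : ℝ)..(1/2), f (y + t) * J t =
      ∫ t in (-(1/2) : ℝ)..(1/2), f (y - t) * J t := by
    have := intervalIntegral.integral_comp_neg (a := -(1/2)) (b := 1/2) (fun t => f (y + t) * J t)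
    simp only [neg_neg, hJe, ← sub_eq_add_neg] at this
    exact this.symm
  have e2 : 2 * ((∫ t in (-(1/2) : ℝ)..(1/2), f (y - t) * J t) - f y) =
      ∫ t in (-(1/2) : ℝ)..(1/2), (f (y + t) - 2 * f y + f (y - t)) * J t := by
    have : ∀ t, (f (y + t) - 2 * f y + f (y - t)) * J t =
      f (y + t) * J t - 2 * f y * J t + f (y - t) * J t := fun t => by ring
    simp only [this]
    rw [intervalIntegral.integral_add (i2.sub i3) i1, intervalIntegral.integral_sub i2 i3,
      intervalIntegral.integral_const_mul, hJ1, e1]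
    ring
  have pt : ∀ t ∈ Set.Icc (-(1/2) : ℝ) (1/2), |f (y + t) - 2 * f y + f (y - t)| ≤
      32 * H * ((M * t) ^ 4 + 625) := by
    intro t ht
    have ht' := abs_le.2 ht
    set u := (M:ℝ) * |t| with hu
    have u0 : 0 ≤ u := by positivity
    have uM : u ≤ M := by rw [hu]; nlinarith [abs_nonneg t]
    have f1 := Nat.floor_le u0
    have f2 := (Nat.lt_floor_add_one u).le
    have f3 : ⌊u⌋₊ ≤ M := Nat.floor_le_of_le uM
    have hb : |t| + 3 * (1 / M) ≤ ((⌊u⌋₊ + 4 : ℕ) : ℝ) * (1 / M) := by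
      have : |t| = u * (1 / M) := by rw [hu]; field_simp
      rw [this, ← add_mul]
      gcongr
      push_cast; linarith
    have hx := abs_le.1 hxy
    have ha := abs_le.1 (le_refl |t|)
    have s := second_diff_le_Hfun hf (δ := 1 / M) (by positivity) (m := ⌊u⌋₊ + 4) (R := M + 4)
      (by omega) (by omega) (x := x) (t := y - t) (H := t)
      (by rw [abs_le]; constructor <;> linarith) (by rw [abs_le]; constructor <;> linarith)
    rw [show y - t + 2 * t = y + t by ring, sub_add_cancel] at s
    refine s.trans ?_
    have g1 : ((((⌊u⌋₊ + 4 : ℕ) : ℝ)) + 1) ^ 4 ≤ (u + 5) ^ 4 := by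
      apply pow_le_pow_left₀ (by positivity)
      push_cast; linarith
    have g2 : (u + 5) ^ 4 ≤ 8 * (u ^ 4 + 5 ^ 4) := by
      have := add_pow_le u0 (by norm_num : (0:ℝ) ≤ 5) 4
      norm_num at this ⊢
      linarith
    have g3 : u ^ 4 = (M * t) ^ 4 := by
      rw [hu, mul_pow, mul_pow, Even.pow_abs (by decide)]
    rw [g3] at g2
    calc _ ≤ 4 * (8 * ((M * t) ^ 4 + 5 ^ 4)) * H := by gcongr; exact g1.trans g2
      _ = _ := by ring
  have ie : IntervalIntegrable (fun t => 32 * H * ((M * t) ^ 4 * J t + 625 * J t)) volume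
      (-(1/2)) (1/2) := Continuous.intervalIntegrable (by fun_prop) _ _
  have b : |∫ t in (-(1/2) : ℝ)..(1/2), (f (y + t) - 2 * f y + f (y - t)) * J t| ≤
      ∫ t in (-(1/2) : ℝ)..(1/2), 32 * H * ((M * t) ^ 4 * J t + 625 * J t) := by
    have := intervalIntegral.norm_integral_le_of_norm_le
      (f := fun t => (f (y + t) - 2 * f y + f (y - t)) * J t)
      (g := fun t => 32 * H * ((M * t) ^ 4 * J t + 625 * J t))
      (by norm_num : (-(1/2) : ℝ) ≤ 1/2) (μ := volume) ?_ ie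
    · simpa using this
    · refine Eventually.of_forall fun t ht => ?_
      rw [norm_mul, Real.norm_eq_abs, Real.norm_eq_abs, abs_of_nonneg (hJ0 t)]
      have := mul_le_mul_of_nonneg_right (pt t ⟨ht.1.le, ht.2⟩) (hJ0 t)
      linarith
  rw [intervalIntegral.integral_const_mul, intervalIntegral.integral_add
    (Continuous.intervalIntegrable (by fun_prop) _ _)
    (Continuous.intervalIntegrable (by fun_prop) _ _), intervalIntegral.integral_const_mul, hJ1,
    ← e2, abs_mul, abs_of_pos two_pos] at b
  have : 32 * H * ((∫ t in (-(1/2) : ℝ)..(1/2), (M * t) ^ 4 * J t) + 625 * 1) ≤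
    32 * H * (16 + 625 * 1) := by gcongr
  linarith

theorem jackson_M {p : ℝ} (hp : 1 ≤ p) {f : ℝ → ℝ} (hf : Nice f) {M n : ℕ} (hM : 1 ≤ M)
    (hMn : 3 * (M - 1) ≤ n) :
    tildeE n p f ≤ 41024 * wConst * tauMod 2 p f (1 / M) := by
  have hM' : (0:ℝ) < M := by exact_mod_cast hM
  obtain ⟨J, hJt, hJ0, hJe, hJ1, hJm⟩ := jackson_kernel hM
  have hJt := hJt.mono hMn
  have hJc := hJt.continuous
  set h := Hfun f (1 / M) (M + 4) with hh
  have hN : Nice h := hf.Hfun _ _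
  obtain ⟨-, m1, K, b1⟩ := id hN
  have hab : (-(1/2) : ℝ) ≤ 1/2 := by norm_num
  set T := fun x => ∫ t in (-(1/2) : ℝ)..(1/2), f (x - t) * J t with hT
  set U := fun x => ∫ t in (-(1/2) : ℝ)..(1/2), h (x - t) * J t with hU
  have hTt : IsTrigPoly n T := conv_trig hJt hf
  have hUt : IsTrigPoly n U := conv_trig hJt hN
  have hUn : LpNorm p U ≤ wConst * tauMod 2 p f (1 / M) :=
    (LpNorm_conv hp hab hJc hJ0 hJ1 hN).trans (LpNorm_Hfun hp hf _ _)
  have key : ∀ y, |T y - f y| ≤ 20512 * U y := by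
    intro y
    set E := |T y - f y| with hE
    have E0 : 0 ≤ E := abs_nonneg _
    have pt : ∀ t, E / 10256 * (J t - (1 / 81) * ((M * t) ^ 4 * J t)) ≤ h (y - t) * J t := by
      intro t
      have hJt0 := hJ0 t
      by_cases ht : |t| ≤ 3 * (1 / M)
      · have e := conv_err hM hf hJc hJ0 hJe hJ1 hJm (x := y - t) (y := y)
          (by rw [sub_sub_cancel]; exact ht)
        have e' : E / 10256 ≤ h (y - t) := by
          rw [div_le_iff₀ (by norm_num), mul_comm]; exact e
        calc E / 10256 * (J t - (1 / 81) * ((M * t) ^ 4 * J t)) ≤ E / 10256 * J t := by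
              gcongr
              have : 0 ≤ (1 / 81) * ((M * t) ^ 4 * J t) := by positivity
              linarith
          _ ≤ _ := by gcongr
      · push Not at ht
        have h1 : 3 ≤ |M * t| := by
          rw [abs_mul, abs_of_pos hM']
          have := mul_lt_mul_of_pos_left ht hM'
          rw [show (M:ℝ) * (3 * (1 / M)) = 3 by field_simp] at this
          exact this.le
        have h2 : (3:ℝ) ^ 4 ≤ (M * t) ^ 4 := by
          rw [← Even.pow_abs (by decide : Even 4) ((M:ℝ) * t)]
          gcongr
        have h3 : J t - (1 / 81) * ((M * t) ^ 4 * J t) ≤ 0 := by nlinarith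
        have h4 : E / 10256 * (J t - (1 / 81) * ((M * t) ^ 4 * J t)) ≤ 0 :=
          mul_nonpos_of_nonneg_of_nonpos (by positivity) h3
        have h5 : 0 ≤ h (y - t) * J t := mul_nonneg (Hfun_nonneg _ _ _ _) hJt0
        linarith
    have i := intervalIntegral.integral_mono_on (μ := volume) hab
      (f := fun t => E / 10256 * (J t - (1 / 81) * ((M * t) ^ 4 * J t)))
      (g := fun t => h (y - t) * J t)
      (Continuous.intervalIntegrable (by fun_prop) _ _)
      (ii_mul (m1.comp (measurable_const.sub measurable_id)) (fun t => b1 _) hJc _ _)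
      (fun t _ => pt t)
    rw [intervalIntegral.integral_const_mul, intervalIntegral.integral_sub
      (Continuous.intervalIntegrable (by fun_prop) _ _)
      (Continuous.intervalIntegrable (by fun_prop) _ _), intervalIntegral.integral_const_mul,
      hJ1] at i
    have j : E / 10256 * (1 / 2) ≤ U y := by
      refine le_trans ?_ i
      gcongr
      linarith
    linarith
  have hmem : LpNorm p (fun x => (T x + 20512 * U x) - (T x - 20512 * U x)) ∈
      {y | ∃ Q q : ℝ → ℝ, IsTrigPoly n Q ∧ IsTrigPoly n q ∧
      (∀ x, q x ≤ f x ∧ f x ≤ Q x) ∧ y = LpNorm p (fun x => Q x - q x)} := by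
    refine ⟨fun x => T x + 20512 * U x, fun x => T x - 20512 * U x,
      hTt.add (hUt.const_mul _), hTt.sub (hUt.const_mul _), fun x => ?_, rfl⟩
    have := abs_le.1 (key x)
    constructor
    · show T x - 20512 * U x ≤ f x
      linarith
    · show f x ≤ T x + 20512 * U x
      linarith
  have hle : tildeE n p f ≤ LpNorm p (fun x => (T x + 20512 * U x) - (T x - 20512 * U x)) := by
    apply csInf_le _ hmem
    refine ⟨0, ?_⟩
    rintro y ⟨Q, q, -, -, -, rfl⟩
    exact LpNorm_nonneg _ _
  refine hle.trans ?_
  have e : (fun x => (T x + 20512 * U x) - (T x - 20512 * U x)) = fun x => 41024 * U x := by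
    funext x; ring
  rw [e, LpNorm_const_mul hp hUt.nice, abs_of_pos (by norm_num), mul_assoc]
  gcongr

theorem jackson {p : ℝ} (hp : 1 ≤ p) {f : ℝ → ℝ} (hf : Nice f) {n : ℕ} (hn : 1 ≤ n) :
    tildeE n p f ≤ 41024 * |wConst| * 252 * tauMod 2 p f (1 / n) := by
  have hn' : (0:ℝ) < n := by exact_mod_cast hn
  have a := jackson_M hp hf (M := n / 3 + 1) (n := n) (by omega) (by omega)
  have b := tau_two_scale hp hf (δ := 1 / n) (by positivity) (m := 3) (by norm_num)
  have c : (1:ℝ) / ((n / 3 + 1 : ℕ) : ℝ) ≤ (3:ℕ) * (1 / n) := by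
    have : (n:ℝ) ≤ 3 * ((n / 3 + 1 : ℕ) : ℝ) := by
      have : n ≤ 3 * (n / 3 + 1) := by omega
      exact_mod_cast this
    rw [div_le_iff₀ (by positivity)]
    push_cast at this ⊢
    field_simp
    linarith
  have d := tauMod_mono hp hf two_pos c
  have t0 := tauMod_nonneg 2 p f (1 / ((n / 3 + 1 : ℕ) : ℝ))
  refine a.trans ?_
  calc _ ≤ 41024 * |wConst| * tauMod 2 p f (1 / ((n / 3 + 1 : ℕ) : ℝ)) := by
        gcongr; exact le_abs_self _
    _ ≤ 41024 * |wConst| * (252 * tauMod 2 p f (1 / n)) := by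
        gcongr
        refine d.trans (b.trans (le_of_eq ?_))
        norm_num
    _ = _ := by ring

theorem localMod_one_large {f : ℝ → ℝ} (hf : Nice f) (x δ : ℝ) :
    localMod 1 f x δ ≤ localMod 1 f x 1 := by
  apply localMod_one_le (localMod_nonneg _ _ _ _)
  intro s t _ _
  have red : ∀ s, ∃ s', |s' - x| ≤ 1 / 2 ∧ f s' = f s := fun s => by
    refine ⟨s - round (s - x), ?_, ?_⟩
    · have := abs_sub_round (s - x)
      rwa [show s - (round (s - x) : ℝ) - x = s - x - round (s - x) by ring]
    · have := hf.1.sub_int_mul_eq (x := s) (round (s - x))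
      rwa [mul_one] at this
  obtain ⟨s', h1, h2⟩ := red s
  obtain ⟨t', h3, h4⟩ := red t
  rw [← h2, ← h4]
  exact le_localMod_one hf h1 h3

theorem forward {p : ℝ} (hp : 1 ≤ p) {f : ℝ → ℝ} (hf : Nice f)
    (H : ∃ G : ℝ, 0 < G ∧ ∀ n : ℕ, 1 ≤ n → tauMod 1 p f (1 / (n : ℝ)) ≤ G * tildeE n p f) :
    ∃ F : ℝ, 0 < F ∧ ∀ δ : ℝ, 0 < δ → tauMod 1 p f δ ≤ F * tauMod 2 p f δ := by
  obtain ⟨G, hG, H⟩ := H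
  set C := 41024 * |wConst| * 252 with hC
  have hC0 : 0 ≤ C := by positivity
  have H' : ∀ n : ℕ, 1 ≤ n → tauMod 1 p f (1 / (n : ℝ)) ≤ G * C * tauMod 2 p f (1 / n) :=
    fun n hn => (H n hn).trans (by
      rw [mul_assoc]
      exact mul_le_mul_of_nonneg_left (jackson hp hf hn) hG.le)
  refine ⟨G * C * 80 + 1, by positivity, fun δ hδ => ?_⟩
  have t0 := tauMod_nonneg 2 p f δ
  have GC : 0 ≤ G * C := by positivity
  suffices h : tauMod 1 p f δ ≤ G * C * (80 * tauMod 2 p f δ) by linarith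
  rcases le_total δ 1 with h1 | h1
  · set n := ⌊1 / δ⌋₊ with hn
    have hd : 1 ≤ 1 / δ := by rw [le_div_iff₀ hδ]; linarith
    have n1 : 1 ≤ n := Nat.le_floor (by exact_mod_cast hd)
    have hn' : (1:ℝ) ≤ n := by exact_mod_cast n1
    have a1 : (n:ℝ) ≤ 1 / δ := Nat.floor_le (by positivity)
    have a2 : 1 / δ < n + 1 := Nat.lt_floor_add_one _
    rw [le_div_iff₀ hδ] at a1
    rw [div_lt_iff₀ hδ] at a2
    have b1 : δ ≤ 1 / n := by
      rw [le_div_iff₀ (by positivity)]; linarith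
    have b2 : 1 / (n:ℝ) ≤ (2:ℕ) * δ := by
      rw [div_le_iff₀ (by positivity)]; push_cast; nlinarith
    refine (tauMod_mono hp hf one_pos b1).trans ((H' n n1).trans ?_)
    gcongr
    refine (tauMod_mono hp hf two_pos b2).trans
      ((tau_two_scale hp hf hδ two_pos).trans (le_of_eq ?_))
    norm_num
  · have a : tauMod 1 p f δ ≤ tauMod 1 p f 1 := by
      rw [tauMod_eq 1 p f 1]
      exact tauMod_le hp hf (hf.localMod one_pos 1) one_pos fun x => localMod_one_large hf x δ
    have b := H' 1 le_rfl
    simp only [Nat.cast_one, div_one] at b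
    refine a.trans (b.trans ?_)
    gcongr
    have := tauMod_mono hp hf two_pos h1
    linarith

theorem stmt2 (p : ℝ) (hp : 1 ≤ p) (f : ℝ → ℝ) (hper : Function.Periodic f 1)
    (hmeas : Measurable f) (hbdd : ∃ M : ℝ, ∀ x, |f x| ≤ M) :
    (∃ G : ℝ, 0 < G ∧ ∀ n : ℕ, 1 ≤ n → tauMod 1 p f (1 / (n : ℝ)) ≤ G * tildeE n p f) ↔
      (∃ F : ℝ, 0 < F ∧ ∀ δ : ℝ, 0 < δ → tauMod 1 p f δ ≤ F * tauMod 2 p f δ) := by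
  exact ⟨forward hp ⟨hper, hmeas, hbdd⟩, backward hp ⟨hper, hmeas, hbdd⟩⟩
end
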